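/- Assume n is even, let s be an integer with 1 ≤ s ≤ 2n−3 and s ≠ n−1, and let p = gcd(n−1, s). Then the number of elements of NC^D(n) that are invariant under σ^{s+1}∘ρ^s equals C(2p, p). -/

import Mathlib

/-- The label set `[±n] = {i ∈ ℤ : 1 ≤ |i| ≤ n}`. -/
def signedSet (n : ℕ) : Set ℤ := {i : ℤ | 1 ≤ |i| ∧ |i| ≤ (n : ℤ)}

/-- The clockwise position (a number in `{0, 1, …, 2n-3}`) of a label `i` with `|i| ≠ n`:
the labels `1, …, n-1, -1, …, -(n-1)` are placed clockwise in this order. -/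
noncomputable def posR (n : ℕ) (i : ℤ) : ℝ :=
  if 0 < i then (i : ℝ) - 1 else ((n : ℝ) - 1) + (-(i : ℝ) - 1)

/-- The point `P(i)` of the plane carrying label `i`: the labels `1, …, n-1, -1, …, -(n-1)`
sit clockwise, in this order, at the vertices of a regular `(2n-2)`-gon centered at the
origin (the vertices of the unit circle at angles `-2πk/(2n-2)`), while the labels `n` and
`-n` both sit at the origin, its centroid. -/
noncomputable def pt (n : ℕ) (i : ℤ) : ℝ × ℝ :=
  if |i| = (n : ℤ) then (0, 0)
  else (Real.cos (-(2 * Real.pi * posR n i / (2 * (n : ℝ) - 2))),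
        Real.sin (-(2 * Real.pi * posR n i / (2 * (n : ℝ) - 2))))

/-- The convex hull `c(B)` of the set of points carrying the labels in `B`. -/
noncomputable def hullOf (n : ℕ) (B : Set ℤ) : Set (ℝ × ℝ) := convexHull ℝ (pt n '' B)

/-- Two blocks `B`, `B'` cross if their convex hulls do not coincide and one of the hulls
contains a point of the other in its relative interior. -/
def Crosses (n : ℕ) (B B' : Set ℤ) : Prop :=
  hullOf n B ≠ hullOf n B' ∧
    ((∃ x ∈ hullOf n B', x ∈ intrinsicInterior ℝ (hullOf n B)) ∨
     (∃ x ∈ hullOf n B, x ∈ intrinsicInterior ℝ (hullOf n B')))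

/-- `w` is a set partition of `S ⊆ ℤ`. -/
def IsPartitionOf (S : Set ℤ) (w : Set (Set ℤ)) : Prop :=
  (∀ B ∈ w, B.Nonempty) ∧ (∀ B ∈ w, B ⊆ S) ∧ ∀ x ∈ S, ∃! B, B ∈ w ∧ x ∈ B

/-- A `D_n`-partition: a set partition of `[±n]` such that `-B` is a block whenever `B` is,
at most one block (the zero block) contains some pair `i, -i`, and the zero block, if
present, is not of the form `{i, -i}` for a single `i`. -/
def IsDnPartition (n : ℕ) (w : Set (Set ℤ)) : Prop :=
  IsPartitionOf (signedSet n) w ∧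
  (∀ B ∈ w, (fun i : ℤ => -i) '' B ∈ w) ∧
  (∀ B ∈ w, ∀ B' ∈ w, (∃ i, i ∈ B ∧ -i ∈ B) → (∃ i, i ∈ B' ∧ -i ∈ B') → B = B') ∧
  (∀ B ∈ w, ∀ i : ℤ, B ≠ {i, -i})

/-- `NCD n` is the set of `D_n`-partitions in which no two blocks cross. -/
def NCD (n : ℕ) : Set (Set (Set ℤ)) :=
  {w | IsDnPartition n w ∧ ∀ B ∈ w, ∀ B' ∈ w, B ≠ B' → ¬ Crosses n B B'}

/-- The function underlying the permutation `ρ` of `[±n]`: the cycle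
`(1, 2, …, n-1, -1, -2, …, -(n-1))`, fixing `n` and `-n`. -/
def rhoFun (n : ℕ) (i : ℤ) : ℤ :=
  if 1 ≤ i ∧ i < (n : ℤ) - 1 then i + 1
  else if i = (n : ℤ) - 1 then -1
  else if -((n : ℤ) - 1) < i ∧ i ≤ -1 then i - 1
  else if i = -((n : ℤ) - 1) then 1
  else i

/-- The function underlying the permutation `σ` of `[±n]`: the transposition exchanging
`n` and `-n`. -/
def sigmaFun (n : ℕ) (i : ℤ) : ℤ :=
  if i = (n : ℤ) then -(n : ℤ) else if i = -(n : ℤ) then (n : ℤ) else i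

/-- A partition `w` is invariant under `g` if the image partition under `g` equals `w`. -/
def InvUnder (g : ℤ → ℤ) (w : Set (Set ℤ)) : Prop := (fun B => g '' B) '' w = w



/-- periodic noncrossing equivalence relations on the integers -/
structure IsM2 (p : ℤ) (S : ℤ → ℤ → Prop) : Prop where
  refl : ∀ x, S x x
  symm : ∀ {x y}, S x y → S y x
  trans : ∀ {x y z}, S x y → S y z → S x z
  per : ∀ x y, S x y ↔ S (x + p) (y + p)
  nc : ∀ {x y z t}, x < y → y < z → z < t → S x z → S y t → S x y

open Classical in
/-- indicator of a proposition -/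
noncomputable def ind (P : Prop) : ℤ := if P then 1 else 0

lemma ind_cases (P : Prop) : (P ∧ ind P = 1) ∨ (¬ P ∧ ind P = 0) := by
  by_cases h : P <;> simp [ind, h]

/-- relation of a height function -/
def Sh (h : ℤ → ℤ) (L : ℤ → Prop) (x y : ℤ) : Prop :=
  h x = h y ∧ ∀ z, min x y ≤ z → z < max x y → h x ≤ h z - ind (L z)

lemma Sh_isM2 (p : ℤ) (h : ℤ → ℤ) (F L : ℤ → Prop)
    (hstep : ∀ x, h (x + 1) = h x - ind (L x) + ind (F (x + 1)))
    (hper : ∀ x, h (x + p) = h x) (hL : ∀ x, L (x + p) ↔ L x) : IsM2 p (Sh h L) := by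
  refine ⟨?_, ?_, ?_, ?_, ?_⟩
  · intro x
    exact ⟨rfl, fun z h1 h2 => by simp at h1 h2; omega⟩
  · rintro x y ⟨h1, h2⟩
    refine ⟨h1.symm, fun z hz1 hz2 => ?_⟩
    rw [← h1]
    exact h2 z (by omega) (by omega)
  · rintro x y z ⟨h1, h2⟩ ⟨h3, h4⟩
    refine ⟨h1.trans h3, fun t ht1 ht2 => ?_⟩
    by_cases hc : min x y ≤ t ∧ t < max x y
    · exact h2 t hc.1 hc.2
    · have := h4 t (by omega) (by omega)
      omega
  · intro x y
    constructor
    · rintro ⟨h1, h2⟩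
      refine ⟨by rw [hper, hper, h1], fun z hz1 hz2 => ?_⟩
      have h3 := h2 (z - p) (by omega) (by omega)
      have h4 := hper (z - p)
      have h5 := hL (z - p)
      simp only [sub_add_cancel] at h4 h5
      rw [hper, h4, h5]
      exact h3
    · rintro ⟨h1, h2⟩
      rw [hper, hper] at h1
      refine ⟨h1, fun z hz1 hz2 => ?_⟩
      have h3 := h2 (z + p) (by omega) (by omega)
      rw [hper, hper, hL] at h3
      exact h3
  · rintro x y z t hxy hyz hzt ⟨h1, h2⟩ ⟨h3, h4⟩
    have a1 := h2 (y - 1) (by omega) (by omega)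
    have a2 := h4 (z - 1) (by omega) (by omega)
    have a3 := hstep (y - 1)
    have a4 := hstep (z - 1)
    simp only [sub_add_cancel] at a3 a4
    have a5 := ind_cases (F y)
    have a6 := ind_cases (F z)
    refine ⟨by omega, fun u hu1 hu2 => h2 u (by omega) (by omega)⟩

lemma Sh_F (p : ℤ) (hp : 0 < p) (h : ℤ → ℤ) (F L : ℤ → Prop)
    (hstep : ∀ x, h (x + 1) = h x - ind (L x) + ind (F (x + 1)))
    (hper : ∀ x, h (x + p) = h x) (x : ℤ) : F x ↔ ¬ ∃ y, y < x ∧ Sh h L y x := by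
  have a3 := hstep (x - 1)
  simp only [sub_add_cancel] at a3
  constructor
  · rintro hF ⟨y, hy, h1, h2⟩
    have a1 := h2 (x - 1) (by omega) (by omega)
    have a5 := ind_cases (F x)
    rcases a5 with a5 | a5
    · omega
    · exact a5.1 hF
  · intro hn
    by_contra hF
    apply hn
    have a5 : ind (F x) = 0 := by simp [ind, hF]
    obtain ⟨y, ⟨hy1, hy2⟩, hy3⟩ := Int.exists_greatest_of_bdd (P := fun y => y < x ∧ h y ≤ h x)
      ⟨x, fun z hz => hz.1.le⟩ ⟨x - p, by omega, by
        have := hper (x - p); simp only [sub_add_cancel] at this; omega⟩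
    have key : ∀ z, y ≤ z → z < x → h x ≤ h z - ind (L z) := by
      intro z hz1 hz2
      rcases eq_or_lt_of_le hz1 with rfl | hz1
      · have b := hstep y
        by_cases hc : y + 1 = x
        · rw [hc] at b; omega
        · have : ¬ (h (y + 1) ≤ h x) := fun hh => by
            have := hy3 (y + 1) ⟨by omega, hh⟩; omega
          have := ind_cases (F (y + 1))
          omega
      · have : ¬ (h z ≤ h x) := fun hh => by
          have := hy3 z ⟨by omega, hh⟩; omega
        have := ind_cases (L z)
        omega
    have k0 := key y le_rfl hy1
    have := ind_cases (L y)
    have hxy : h y = h x := by omega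
    refine ⟨y, hy1, hxy, fun z hz1 hz2 => ?_⟩
    rw [hxy]
    exact key z (by omega) (by omega)

lemma Sh_L (p : ℤ) (hp : 0 < p) (h : ℤ → ℤ) (F L : ℤ → Prop)
    (hstep : ∀ x, h (x + 1) = h x - ind (L x) + ind (F (x + 1)))
    (hper : ∀ x, h (x + p) = h x) (x : ℤ) : L x ↔ ¬ ∃ y, x < y ∧ Sh h L x y := by
  constructor
  · rintro hF ⟨y, hy, h1, h2⟩
    have a1 := h2 x (by omega) (by omega)
    have a5 := ind_cases (L x)
    rcases a5 with a5 | a5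
    · omega
    · exact a5.1 hF
  · intro hn
    by_contra hF
    apply hn
    have a5 : ind (L x) = 0 := by simp [ind, hF]
    obtain ⟨y, ⟨hy1, hy2⟩, hy3⟩ := Int.exists_least_of_bdd (P := fun y => x < y ∧ h y ≤ h x)
      ⟨x, fun z hz => hz.1.le⟩ ⟨x + p, by omega, by
        have := hper x; omega⟩
    have key : ∀ z, x ≤ z → z < y → h x ≤ h z - ind (L z) := by
      intro z hz1 hz2
      rcases eq_or_lt_of_le hz1 with rfl | hz1
      · omega
      · have : ¬ (h z ≤ h x) := fun hh => by
          have := hy3 z ⟨by omega, hh⟩; omega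
        have := ind_cases (L z)
        omega
    have k0 := key (y - 1) (by omega) (by omega)
    have a3 := hstep (y - 1)
    simp only [sub_add_cancel] at a3
    have := ind_cases (F y)
    have hxy : h x = h y := by omega
    refine ⟨y, hy1, hxy, fun z hz1 hz2 => ?_⟩
    exact key z (by omega) (by omega)

open Classical in
lemma ht_count (h : ℤ → ℤ) (F L : ℤ → Prop)
    (hstep : ∀ x, h (x + 1) = h x - ind (L x) + ind (F (x + 1))) (x z : ℤ) (hxz : x ≤ z) :
    h z - ind (L z) = h x + ((Finset.Ioc x z).filter F).card
      - ((Finset.Icc x z).filter L).card := by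
  induction z, hxz using Int.leInduction with
  | base => 
    simp [Finset.filter_singleton]
    by_cases hL : L x <;> simp [ind, hL]
  | succ z hz ih =>
    have e1 : Finset.Ioc x (z + 1) = insert (z + 1) (Finset.Ioc x z) := by
      ext; simp; omega
    have e2 : Finset.Icc x (z + 1) = insert (z + 1) (Finset.Icc x z) := by
      ext; simp; omega
    rw [e1, e2, Finset.filter_insert, Finset.filter_insert, hstep, ih]
    by_cases hF : F (z + 1) <;> by_cases hL : L (z + 1) <;>
      simp [ind, hF, hL] <;> ring

lemma exists_min (p : ℤ) (S : ℤ → ℤ → Prop) (hS : IsM2 p S) (v l : ℤ)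
    (hb : ∀ u, S u v → l < u) : ∃ u, l < u ∧ u ≤ v ∧ S u v ∧ ¬ ∃ y, y < u ∧ S y u := by
  obtain ⟨u, hu1, hu2⟩ := Int.exists_least_of_bdd (P := fun y => S y v)
      ⟨l, fun z hz => (hb z hz).le⟩ ⟨v, hS.refl v⟩
  refine ⟨u, hb u hu1, hu2 v (hS.refl v), hu1, ?_⟩
  rintro ⟨y, hy, hyu⟩
  have := hu2 y (hS.trans hyu hu1)
  omega

lemma exists_max (p : ℤ) (S : ℤ → ℤ → Prop) (hS : IsM2 p S) (v l : ℤ)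
    (hb : ∀ u, S v u → u < l) : ∃ u, u < l ∧ v ≤ u ∧ S v u ∧ ¬ ∃ y, u < y ∧ S u y := by
  obtain ⟨u, hu1, hu2⟩ := Int.exists_greatest_of_bdd (P := fun y => S v y)
      ⟨l, fun z hz => (hb z hz).le⟩ ⟨v, hS.refl v⟩
  refine ⟨u, hb u hu1, hu2 v (hS.refl v), hu1, ?_⟩
  rintro ⟨y, hy, hyu⟩
  have := hu2 y (hS.trans hu1 hyu)
  omega

lemma confine (p : ℤ) (S : ℤ → ℤ → Prop) (hS : IsM2 p S) {x y v u : ℤ} (h1 : S x y)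
    (hx : x < v) (hy : v < y) (hn : ¬ S x v) (hu : S v u) : x < u ∧ u < y := by
  have hux : u ≠ x := by rintro rfl; exact hn (hS.symm hu)
  have huy : u ≠ y := by rintro rfl; exact hn (hS.trans h1 (hS.symm hu))
  constructor
  · by_contra hc
    exact hn (hS.trans (hS.symm (hS.nc (show u < x by omega) hx hy (hS.symm hu) h1)) (hS.symm hu))
  · by_contra hc
    exact hn (hS.nc hx hy (show y < u by omega) h1 hu)

open Classical in
lemma S_imp_Sh (p : ℤ) (S : ℤ → ℤ → Prop) (hS : IsM2 p S) (h : ℤ → ℤ) (F L : ℤ → Prop)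
    (hF : ∀ x, F x ↔ ¬ ∃ y, y < x ∧ S y x) (hL : ∀ x, L x ↔ ¬ ∃ y, x < y ∧ S x y)
    (hstep : ∀ x, h (x + 1) = h x - ind (L x) + ind (F (x + 1)))
    {x y : ℤ} (hxy : x < y) (hs : S x y) : Sh h L x y := by
  have hLx : ∀ v, L v → x ≤ v → v < y → ¬ S x v := fun v hv h1 h2 h3 =>
    (hL v).1 hv ⟨y, h2, hS.trans (hS.symm h3) hs⟩
  have hFx : ∀ v, F v → x < v → v ≤ y → ¬ S x v := fun v hv h1 h2 h3 =>
    (hF v).1 hv ⟨x, h1, h3⟩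
  have hLm : ∀ v, L v → x ≤ v → v < y → ∃ u, x < u ∧ u ≤ v ∧ S u v ∧ F u := by
    intro v hv h1 h2
    have h3 := hLx v hv h1 h2
    have h4 : x ≠ v := by rintro rfl; exact h3 (hS.refl _)
    obtain ⟨u, hu⟩ := exists_min p S hS v x
      (fun u hu => (confine p S hS hs (by omega) h2 h3 (hS.symm hu)).1)
    exact ⟨u, hu.1, hu.2.1, hu.2.2.1, (hF u).2 hu.2.2.2⟩
  have hFm : ∀ v, F v → x < v → v ≤ y → ∃ u, u < y ∧ v ≤ u ∧ S v u ∧ L u := by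
    intro v hv h1 h2
    have h3 := hFx v hv h1 h2
    have h4 : v ≠ y := by rintro rfl; exact h3 hs
    obtain ⟨u, hu⟩ := exists_max p S hS v y
      (fun u hu => (confine p S hS hs h1 (by omega) h3 hu).2)
    exact ⟨u, hu.1, hu.2.1, hu.2.2.1, (hL u).2 hu.2.2.2⟩
  have uL : ∀ v v' u, L v → L v' → S u v → S u v' → v = v' := by
    intro v v' u h1 h2 h3 h4
    rw [hL] at h1 h2
    by_contra hne
    rcases lt_or_gt_of_ne hne with hlt | hlt
    · exact h1 ⟨v', hlt, hS.trans (hS.symm h3) h4⟩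
    · exact h2 ⟨v, hlt, hS.trans (hS.symm h4) h3⟩
  have uF : ∀ v v' u, F v → F v' → S u v → S u v' → v = v' := by
    intro v v' u h1 h2 h3 h4
    rw [hF] at h1 h2
    by_contra hne
    rcases lt_or_gt_of_ne hne with hlt | hlt
    · exact h2 ⟨v, hlt, hS.trans (hS.symm h3) h4⟩
    · exact h1 ⟨v', hlt, hS.trans (hS.symm h4) h3⟩
  have pre : ∀ z, x ≤ z → z < y → h x ≤ h z - ind (L z) := by
    intro z h1 h2
    rw [ht_count h F L hstep x z h1]
    have : ((Finset.Icc x z).filter L).card ≤ ((Finset.Ioc x z).filter F).card := by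
      apply Finset.card_le_card_of_forall_subsingleton (fun v u => S u v)
      · intro v hv
        simp only [Finset.mem_filter, Finset.mem_Icc] at hv
        obtain ⟨u, hu1, hu2, hu3, hu4⟩ := hLm v hv.2 hv.1.1 (by omega)
        exact ⟨u, by simp only [Finset.mem_filter, Finset.mem_Ioc]; exact ⟨by omega, hu4⟩, hu3⟩
      · intro u hu v hv v' hv'
        simp at hv hv'
        exact uL v v' u hv.1.2 hv'.1.2 hv.2 hv'.2
    omega
  have hfin : h y ≤ h x := by
    have e1 := ht_count h F L hstep x (y - 1) (by omega)
    have e2 := hstep (y - 1)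
    simp only [sub_add_cancel] at e2
    have : ((Finset.Ioc x y).filter F).card ≤ ((Finset.Icc x (y - 1)).filter L).card := by
      apply Finset.card_le_card_of_forall_subsingleton (fun v u => S u v)
      · intro v hv
        simp only [Finset.mem_filter, Finset.mem_Ioc] at hv
        obtain ⟨u, hu1, hu2, hu3, hu4⟩ := hFm v hv.2 hv.1.1 (by omega)
        exact ⟨u, by simp only [Finset.mem_filter, Finset.mem_Icc]; exact ⟨by omega, hu4⟩,
          hS.symm hu3⟩
      · intro u hu v hv v' hv'
        simp at hv hv'
        exact uF v v' u hv.1.2 hv'.1.2 hv.2 hv'.2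
    have e3 : Finset.Ioc x y = insert y (Finset.Ioc x (y - 1)) := by
      ext; simp; omega
    rw [e3, Finset.filter_insert] at this
    by_cases hFy : F y
    · simp [hFy] at this
      simp [hFy, ind] at e2 e1
      omega
    · simp [hFy] at this
      simp [hFy, ind] at e2 e1
      omega
  have k := pre (y - 1) (by omega) (by omega)
  have e2 := hstep (y - 1)
  simp only [sub_add_cancel] at e2
  have := ind_cases (F y)
  exact ⟨by omega, fun z hz1 hz2 => pre z (by omega) (by omega)⟩

open Classical in
lemma Sh_imp_S (p : ℤ) (S : ℤ → ℤ → Prop) (hS : IsM2 p S) (h : ℤ → ℤ) (F L : ℤ → Prop)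
    (hF : ∀ x, F x ↔ ¬ ∃ y, y < x ∧ S y x) (hL : ∀ x, L x ↔ ¬ ∃ y, x < y ∧ S x y)
    (hstep : ∀ x, h (x + 1) = h x - ind (L x) + ind (F (x + 1)))
    {x y : ℤ} (hxy : x < y) (hs : Sh h L x y) : S x y := by
  by_contra hn
  obtain ⟨x', ⟨hx1, hx2, hx3⟩, hx4⟩ := Int.exists_greatest_of_bdd
    (P := fun u => S x u ∧ x ≤ u ∧ u < y) ⟨y, fun z hz => hz.2.2.le⟩ ⟨x, hS.refl x, le_rfl, hxy⟩
  have hx' : h x = h x' := by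
    rcases eq_or_lt_of_le hx2 with rfl | hlt
    · rfl
    · exact (S_imp_Sh p S hS h F L hF hL hstep hlt hx1).1
  have hLx' : ¬ L x' := by
    have h1 := hs.2 x' (by omega) (by omega)
    intro hc
    simp only [ind, hc, if_true] at h1
    omega
  rw [hL, not_not] at hLx'
  obtain ⟨y', hy1, hy2⟩ := hLx'
  have hyy : y < y' := by
    by_contra hc
    rcases eq_or_lt_of_le (not_lt.1 hc) with rfl | hlt
    · exact hn (hS.trans hx1 hy2)
    · have := hx4 y' ⟨hS.trans hx1 hy2, by omega, hlt⟩
      omega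
  have hcl : ∀ v, x' < v → v ≤ y → ¬ S x' v := by
    intro v h1 h2 h3
    rcases eq_or_lt_of_le h2 with rfl | hlt
    · exact hn (hS.trans hx1 h3)
    · have := hx4 v ⟨hS.trans hx1 h3, by omega, hlt⟩
      omega
  have hmin : ∀ v, x' < v → v ≤ y → ∃ u, x' < u ∧ u ≤ v ∧ S u v ∧ F u := by
    intro v h1 h2
    obtain ⟨u, hu⟩ := exists_min p S hS v x'
      (fun u hu => (confine p S hS hy2 h1 (by omega) (hcl v h1 h2) (hS.symm hu)).1)
    exact ⟨u, hu.1, hu.2.1, hu.2.2.1, (hF u).2 hu.2.2.2⟩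
  have uL : ∀ v v' u, L v → L v' → S u v → S u v' → v = v' := by
    intro v v' u h1 h2 h3 h4
    rw [hL] at h1 h2
    by_contra hne
    rcases lt_or_gt_of_ne hne with hlt | hlt
    · exact h1 ⟨v', hlt, hS.trans (hS.symm h3) h4⟩
    · exact h2 ⟨v, hlt, hS.trans (hS.symm h4) h3⟩
  obtain ⟨u0, hu1, hu2, hu3, hu4⟩ := hmin y hx3 le_rfl
  have hcard : ((Finset.Icc x' (y - 1)).filter L).card ≤
      (((Finset.Ioc x' y).filter F).erase u0).card := by
    apply Finset.card_le_card_of_forall_subsingleton (fun v u => S u v)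
    · intro v hv
      simp only [Finset.mem_filter, Finset.mem_Icc] at hv
      have hvx : v ≠ x' := by
        rintro rfl
        exact (hL _).1 hv.2 ⟨y', hy1, hy2⟩
      obtain ⟨u, h1, h2, h3, h4⟩ := hmin v (by omega) (by omega)
      refine ⟨u, ?_, h3⟩
      simp only [Finset.mem_erase, Finset.mem_filter, Finset.mem_Ioc]
      refine ⟨?_, by omega, h4⟩
      rintro rfl
      exact (hL _).1 hv.2 ⟨y, by omega, hS.trans (hS.symm h3) hu3⟩
    · intro u hu v hv v' hv'
      simp at hv hv'
      exact uL v v' u hv.1.2 hv'.1.2 hv.2 hv'.2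
  rw [Finset.card_erase_of_mem (by simp; exact ⟨by omega, hu4⟩)] at hcard
  have hpos : 0 < ((Finset.Ioc x' y).filter F).card :=
    Finset.card_pos.2 ⟨u0, by simp; exact ⟨by omega, hu4⟩⟩
  have e1 := ht_count h F L hstep x' (y - 1) (by omega)
  have e2 := hstep (y - 1)
  simp only [sub_add_cancel] at e2
  have e3 : Finset.Ioc x' y = insert y (Finset.Ioc x' (y - 1)) := by
    ext; simp; omega
  have hh := hs.1
  rw [e3, Finset.filter_insert] at hcard hpos
  by_cases hFy : F y
  · simp [hFy] at hcard
    simp [hFy, ind] at e2 e1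
    omega
  · simp [hFy] at hcard
    simp only [hFy, if_false] at hpos
    simp [hFy, ind] at e2 e1
    omega

lemma Sh_eq_S (p : ℤ) (S : ℤ → ℤ → Prop) (hS : IsM2 p S) (h : ℤ → ℤ) (F L : ℤ → Prop)
    (hF : ∀ x, F x ↔ ¬ ∃ y, y < x ∧ S y x) (hL : ∀ x, L x ↔ ¬ ∃ y, x < y ∧ S x y)
    (hstep : ∀ x, h (x + 1) = h x - ind (L x) + ind (F (x + 1)))
    : Sh h L = S := by
  have hP := @Sh_imp_S p S hS h F L hF hL hstep
  have hQ := @S_imp_Sh p S hS h F L hF hL hstep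
  have hsy : ∀ x y, Sh h L x y → Sh h L y x := by
    rintro x y ⟨h1, h2⟩
    refine ⟨h1.symm, fun z hz1 hz2 => ?_⟩
    rw [← h1]
    exact h2 z (by omega) (by omega)
  funext x y
  apply propext
  rcases lt_trichotomy x y with hlt | rfl | hlt
  · exact ⟨hP hlt, hQ hlt⟩
  · exact ⟨fun _ => hS.refl x, fun _ => ⟨rfl, fun z h1 h2 => by simp at h1 h2; omega⟩⟩
  · exact ⟨fun hh => hS.symm (hP hlt (hsy _ _ hh)), fun hh => hsy _ _ (hQ hlt (hS.symm hh))⟩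

/-- the height function of a pair of finite sets -/
def ht (p : ℤ) (F L : Finset ℤ) (x : ℤ) : ℤ :=
  ((F.filter (· ≤ x % p)).card : ℤ) - ((L.filter (· < x % p)).card : ℤ)

lemma ht_per (p : ℤ) (F L : Finset ℤ) (x : ℤ) : ht p F L (x + p) = ht p F L x := by
  simp [ht]

lemma card_le_succ (F : Finset ℤ) (r : ℤ) :
    ((F.filter (· ≤ r + 1)).card : ℤ) = (F.filter (· ≤ r)).card + ind (r + 1 ∈ F) := by
  have : F.filter (· ≤ r + 1) = F.filter (· ≤ r) ∪ F.filter (· = r + 1) := by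
    ext y; simp only [Finset.mem_filter, Finset.mem_union]
    constructor
    · rintro ⟨h1, h2⟩
      by_cases hy : y ≤ r
      · exact Or.inl ⟨h1, hy⟩
      · exact Or.inr ⟨h1, by omega⟩
    · rintro (⟨h1, h2⟩ | ⟨h1, h2⟩)
      · exact ⟨h1, by omega⟩
      · exact ⟨h1, by omega⟩
  rw [this, Finset.card_union_of_disjoint]
  · rw [Finset.filter_eq']
    by_cases h : r + 1 ∈ F <;> simp [h, ind]
  · rw [Finset.disjoint_filter]
    intro y _ h1 h2
    omega

lemma card_lt_succ (F : Finset ℤ) (r : ℤ) :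
    ((F.filter (· < r + 1)).card : ℤ) = (F.filter (· < r)).card + ind (r ∈ F) := by
  have h := card_le_succ F (r - 1)
  simp only [sub_add_cancel] at h
  have e1 : F.filter (· < r + 1) = F.filter (· ≤ r) := by
    apply Finset.filter_congr; intro y _; omega
  have e2 : F.filter (· < r) = F.filter (· ≤ r - 1) := by
    apply Finset.filter_congr; intro y _; omega
  rw [e1, e2, h]

lemma ht_step (p : ℤ) (hp : 0 < p) (F L : Finset ℤ) (hF : F ⊆ Finset.Ico 0 p)
    (hL : L ⊆ Finset.Ico 0 p) (hc : F.card = L.card) (x : ℤ) :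
    ht p F L (x + 1) = ht p F L x - ind (x % p ∈ L) + ind ((x + 1) % p ∈ F) := by
  have h0 := Int.emod_nonneg x hp.ne'
  have h1 := Int.emod_lt_of_pos x hp
  have hF' : ∀ y ∈ F, 0 ≤ y ∧ y < p := fun y hy => by simpa using hF hy
  have hL' : ∀ y ∈ L, 0 ≤ y ∧ y < p := fun y hy => by simpa using hL hy
  by_cases hr : x % p + 1 < p
  · have e : (x + 1) % p = x % p + 1 := by
      rw [Int.add_emod_eq_add_emod_right (n := p) (m := x) (k := x % p) 1 (by simp)]
      exact Int.emod_eq_of_lt (by omega) hr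
    unfold ht
    rw [e, card_le_succ, card_lt_succ]
    ring
  · have e0 : x % p = p - 1 := by omega
    have e : (x + 1) % p = 0 := by
      rw [Int.add_emod_eq_add_emod_right (n := p) (m := x) (k := x % p) 1 (by simp), e0]
      simp
    unfold ht
    rw [e, e0]
    have a1 := card_le_succ F (-1)
    have a2 : F.filter (· ≤ (-1:ℤ)) = ∅ := by
      rw [Finset.filter_eq_empty_iff]
      intro y hy; have := hF' y hy; omega
    have a3 : L.filter (· < (0:ℤ)) = ∅ := by
      rw [Finset.filter_eq_empty_iff]
      intro y hy; have := hL' y hy; omega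
    have a4 : F.filter (· ≤ p - 1) = F := by
      rw [Finset.filter_eq_self]
      intro y hy; have := hF' y hy; omega
    have a5 := card_lt_succ L (p - 1)
    have a6 : L.filter (· < p - 1 + 1) = L := by
      rw [Finset.filter_eq_self]
      intro y hy; have := hL' y hy; omega
    rw [a2] at a1
    rw [a6] at a5
    simp only [neg_add_cancel, Finset.card_empty] at a1
    rw [a3, a4, a1, hc, a5]
    simp

lemma IsM2.per_mul {p : ℤ} {S : ℤ → ℤ → Prop} (hS : IsM2 p S) (j x y : ℤ) :
    S x y ↔ S (x + p * j) (y + p * j) := by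
  induction j using Int.induction_on with
  | zero => simp
  | succ i ih =>
    rw [ih, hS.per]
    ring_nf
  | pred i ih =>
    rw [ih, hS.per (x + p * (-↑i - 1))]
    ring_nf

lemma bal_le (p : ℤ) (hp : 0 < p) (S : ℤ → ℤ → Prop) (hS : IsM2 p S) (F L : Finset ℤ)
    (hF : ∀ x, x ∈ F ↔ (0 ≤ x ∧ x < p) ∧ ¬ ∃ y, y < x ∧ S y x)
    (hL : ∀ x, x ∈ L ↔ (0 ≤ x ∧ x < p) ∧ ¬ ∃ y, x < y ∧ S x y) : F.card = L.card := by
  have red : ∀ v, v % p + p * (v / p) = v := fun v => Int.emod_add_mul_ediv v p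
  apply le_antisymm
  · apply Finset.card_le_card_of_forall_subsingleton (fun x v => ∃ j, S x (v + p * j))
    · intro x hx
      rw [hF] at hx
      have hno : ¬ S x (x + p) := fun hh => hx.2 ⟨x - p, by omega, by
        rw [hS.per]; simpa using hh⟩
      obtain ⟨u, hu1, hu2, hu3, hu4⟩ := exists_max p S hS x (x + p) (fun u hu => by
        by_contra hc
        rcases eq_or_lt_of_le (not_lt.1 hc) with rfl | hlt
        · exact hno hu
        · exact hno (hS.nc (show x < x + p by omega) hlt (show u < u + p by omega) hu
            ((hS.per _ _).1 hu)))
      refine ⟨u % p, ?_, u / p, by rw [red]; exact hu3⟩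
      rw [hL]
      refine ⟨⟨Int.emod_nonneg _ hp.ne', Int.emod_lt_of_pos _ hp⟩, ?_⟩
      rintro ⟨y, hy1, hy2⟩
      refine hu4 ⟨y + p * (u / p), by have := red u; omega, ?_⟩
      rw [hS.per_mul (u / p), red] at hy2
      exact hy2
    · rintro v hv x ⟨hx, j, hj⟩ x' ⟨hx', j', hj'⟩
      rw [hF] at hx hx'
      have h1 : S (x + p * (-j)) v := by
        have := (hS.per_mul (-j) _ _).1 hj
        ring_nf at this ⊢; exact this
      have h2 : S (x' + p * (-j')) v := by
        have := (hS.per_mul (-j') _ _).1 hj'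
        ring_nf at this ⊢; exact this
      have h3 : x + p * (-j) = x' + p * (-j') := by
        by_contra hne
        rcases lt_or_gt_of_ne hne with hlt | hlt
        · refine hx'.2 ⟨x + p * (-j) + p * j', by linarith, ?_⟩
          have := (hS.per_mul j' _ _).1 (hS.trans h1 (hS.symm h2))
          ring_nf at this ⊢; exact this
        · refine hx.2 ⟨x' + p * (-j') + p * j, by linarith, ?_⟩
          have := (hS.per_mul j _ _).1 (hS.trans h2 (hS.symm h1))
          ring_nf at this ⊢; exact this
      have h4 : (x + p * (-j)) % p = (x' + p * (-j')) % p := by rw [h3]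
      simp only [Int.add_mul_emod_self_left] at h4
      rwa [Int.emod_eq_of_lt hx.1.1 hx.1.2, Int.emod_eq_of_lt hx'.1.1 hx'.1.2] at h4
  · apply Finset.card_le_card_of_forall_subsingleton (fun x v => ∃ j, S x (v + p * j))
    · intro x hx
      rw [hL] at hx
      have hno : ¬ S (x - p) x := fun hh => hx.2 ⟨x + p, by omega, by
        rw [hS.per] at hh; simpa using hh⟩
      obtain ⟨u, hu1, hu2, hu3, hu4⟩ := exists_min p S hS x (x - p) (fun u hu => by
        by_contra hc
        rcases eq_or_lt_of_le (not_lt.1 hc) with rfl | hlt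
        · exact hno hu
        · have a : S (u - p) (x - p) := by rw [hS.per]; simpa using hu
          have b := hS.nc (show u - p < u by omega) hlt (show x - p < x by omega) a hu
          exact hno (hS.trans (hS.symm a) (hS.trans b hu)))
      refine ⟨u % p, ?_, u / p, by rw [red]; exact hS.symm hu3⟩
      rw [hF]
      refine ⟨⟨Int.emod_nonneg _ hp.ne', Int.emod_lt_of_pos _ hp⟩, ?_⟩
      rintro ⟨y, hy1, hy2⟩
      refine hu4 ⟨y + p * (u / p), by have := red u; omega, ?_⟩
      rw [hS.per_mul (u / p), red] at hy2
      exact hy2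
    · rintro v hv x ⟨hx, j, hj⟩ x' ⟨hx', j', hj'⟩
      rw [hL] at hx hx'
      have h1 : S (x + p * (-j)) v := by
        have := (hS.per_mul (-j) _ _).1 hj
        ring_nf at this ⊢; exact this
      have h2 : S (x' + p * (-j')) v := by
        have := (hS.per_mul (-j') _ _).1 hj'
        ring_nf at this ⊢; exact this
      have h3 : x + p * (-j) = x' + p * (-j') := by
        by_contra hne
        rcases lt_or_gt_of_ne hne with hlt | hlt
        · refine hx.2 ⟨x' + p * (-j') + p * j, by linarith, ?_⟩
          have := (hS.per_mul j _ _).1 (hS.trans h1 (hS.symm h2))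
          ring_nf at this ⊢; exact this
        · refine hx'.2 ⟨x + p * (-j) + p * j', by linarith, ?_⟩
          have := (hS.per_mul j' _ _).1 (hS.trans h2 (hS.symm h1))
          ring_nf at this ⊢; exact this
      have h4 : (x + p * (-j)) % p = (x' + p * (-j')) % p := by rw [h3]
      simp only [Int.add_mul_emod_self_left] at h4
      rwa [Int.emod_eq_of_lt hx.1.1 hx.1.2, Int.emod_eq_of_lt hx'.1.1 hx'.1.2] at h4

/-- pairs of subsets of a period with equal cardinality -/
noncomputable def M3 (p : ℤ) : Finset (Finset ℤ × Finset ℤ) :=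
  ((Finset.Ico 0 p).powerset ×ˢ (Finset.Ico 0 p).powerset).filter (fun q => q.1.card = q.2.card)

lemma M3_card (p : ℕ) : (M3 p).card = (2 * p).choose p := by
  rw [M3, Finset.card_filter, Finset.sum_product]
  have : ∀ F ∈ (Finset.Ico (0:ℤ) p).powerset,
      (∑ L ∈ (Finset.Ico (0:ℤ) p).powerset, if F.card = L.card then 1 else 0) =
      p.choose F.card := by
    intro F _
    rw [← Finset.card_filter]
    have : (Finset.Ico (0:ℤ) p).powerset.filter (fun L => F.card = L.card) =
        (Finset.Ico (0:ℤ) p).powersetCard F.card := by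
      ext L; simp [Finset.mem_powersetCard, eq_comm]
    rw [this, Finset.card_powersetCard]; simp
  rw [Finset.sum_congr rfl this, Finset.sum_powerset_apply_card (fun k => p.choose k)]
  simp only [Int.card_Ico, sub_zero, Int.toNat_natCast, smul_eq_mul]
  rw [← Nat.sum_range_choose_sq]
  exact Finset.sum_congr rfl (fun k _ => by ring)

lemma M3_spec (p : ℤ) (hp : 0 < p) (q : Finset ℤ × Finset ℤ) (hq : q ∈ M3 p) :
    IsM2 p (Sh (ht p q.1 q.2) (fun x => x % p ∈ q.2)) ∧
    (∀ x, x % p ∈ q.1 ↔ ¬ ∃ y, y < x ∧ Sh (ht p q.1 q.2) (fun x => x % p ∈ q.2) y x) ∧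
    (∀ x, x % p ∈ q.2 ↔ ¬ ∃ y, x < y ∧ Sh (ht p q.1 q.2) (fun x => x % p ∈ q.2) x y) := by
  simp only [M3, Finset.mem_filter, Finset.mem_product, Finset.mem_powerset] at hq
  have hs := ht_step p hp q.1 q.2 hq.1.1 hq.1.2 hq.2
  have hp' := ht_per p q.1 q.2
  refine ⟨Sh_isM2 p _ (fun x => x % p ∈ q.1) _ hs hp' (fun x => by simp), ?_, ?_⟩
  · exact Sh_F p hp _ (fun x => x % p ∈ q.1) _ hs hp'
  · exact Sh_L p hp _ (fun x => x % p ∈ q.1) _ hs hp'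

open Classical in
lemma M2_card (p : ℕ) (hp : 0 < p) :
    Nat.card {S : ℤ → ℤ → Prop // IsM2 p S} = (2 * p).choose p := by
  have hp' : (0:ℤ) < p := by exact_mod_cast hp
  have hcard : Nat.card {q // q ∈ M3 p} = (2 * p).choose p := by
    rw [Nat.card_eq_fintype_card, Fintype.card_coe, M3_card]
  rw [← hcard]
  symm
  let f : {q // q ∈ M3 p} → {S : ℤ → ℤ → Prop // IsM2 p S} := fun q =>
    ⟨Sh (ht p q.1.1 q.1.2) (fun x => x % p ∈ q.1.2), (M3_spec p hp' q.1 q.2).1⟩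
  apply Nat.card_eq_of_bijective f
  constructor
  · intro q q' hqq
    have e : Sh (ht p q.1.1 q.1.2) (fun x => x % p ∈ q.1.2) =
      Sh (ht p q'.1.1 q'.1.2) (fun x => x % p ∈ q'.1.2) := congrArg Subtype.val hqq
    obtain ⟨-, a1, a2⟩ := M3_spec p hp' q.1 q.2
    obtain ⟨-, b1, b2⟩ := M3_spec p hp' q'.1 q'.2
    rw [← e] at b1 b2
    have hq := q.2
    have hq' := q'.2
    simp only [M3, Finset.mem_filter, Finset.mem_product, Finset.mem_powerset] at hq hq'
    have gen : ∀ A B : Finset ℤ, A ⊆ Finset.Ico (0:ℤ) p → B ⊆ Finset.Ico (0:ℤ) p →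
        (∀ x : ℤ, x % p ∈ A ↔ x % p ∈ B) → A = B := by
      intro A B hA hB hAB
      ext x
      constructor
      · intro hx
        have := hA hx
        rw [Finset.mem_Ico] at this
        have h2 := hAB x
        rw [Int.emod_eq_of_lt this.1 this.2] at h2
        exact h2.1 hx
      · intro hx
        have := hB hx
        rw [Finset.mem_Ico] at this
        have h2 := hAB x
        rw [Int.emod_eq_of_lt this.1 this.2] at h2
        exact h2.2 hx
    apply Subtype.ext
    apply Prod.ext
    · exact gen _ _ hq.1.1 hq'.1.1 (fun x => (a1 x).trans (b1 x).symm)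
    · exact gen _ _ hq.1.2 hq'.1.2 (fun x => (a2 x).trans (b2 x).symm)
  · rintro ⟨S, hS⟩
    let F := (Finset.Ico (0:ℤ) p).filter (fun x => ¬ ∃ y, y < x ∧ S y x)
    let L := (Finset.Ico (0:ℤ) p).filter (fun x => ¬ ∃ y, x < y ∧ S x y)
    have hF : ∀ x, x ∈ F ↔ (0 ≤ x ∧ x < p) ∧ ¬ ∃ y, y < x ∧ S y x := fun x => by
      simp only [F, Finset.mem_filter, Finset.mem_Ico]
    have hL : ∀ x, x ∈ L ↔ (0 ≤ x ∧ x < p) ∧ ¬ ∃ y, x < y ∧ S x y := fun x => by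
      simp only [L, Finset.mem_filter, Finset.mem_Ico]
    have hc := bal_le p hp' S hS F L hF hL
    have hFs : F ⊆ Finset.Ico (0:ℤ) p := Finset.filter_subset _ _
    have hLs : L ⊆ Finset.Ico (0:ℤ) p := Finset.filter_subset _ _
    have hq : (F, L) ∈ M3 p := by
      simp only [M3, Finset.mem_filter, Finset.mem_product, Finset.mem_powerset]
      exact ⟨⟨hFs, hLs⟩, hc⟩
    refine ⟨⟨(F, L), hq⟩, ?_⟩
    apply Subtype.ext
    have red : ∀ v : ℤ, v % p + p * (v / p) = v := fun v => Int.emod_add_mul_ediv v p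
    have hr : ∀ x : ℤ, 0 ≤ x % p ∧ x % p < p := fun x =>
      ⟨Int.emod_nonneg _ hp'.ne', Int.emod_lt_of_pos _ hp'⟩
    refine Sh_eq_S p S hS (ht p F L) (fun x => x % p ∈ F) (fun x => x % p ∈ L) ?_ ?_
      (ht_step p hp' F L hFs hLs hc)
    · intro x
      rw [hF]
      refine (and_iff_right (hr x)).trans (not_congr ?_)
      constructor
      · rintro ⟨y, h1, h2⟩
        refine ⟨y + p * (x / p), by have := red x; omega, ?_⟩
        rw [hS.per_mul (x / p), red] at h2
        exact h2
      · rintro ⟨y, h1, h2⟩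
        refine ⟨y - p * (x / p), by have := red x; omega, ?_⟩
        rw [hS.per_mul (x / p), red]
        simpa using h2
    · intro x
      rw [hL]
      refine (and_iff_right (hr x)).trans (not_congr ?_)
      constructor
      · rintro ⟨y, h1, h2⟩
        refine ⟨y + p * (x / p), by have := red x; omega, ?_⟩
        rw [hS.per_mul (x / p), red] at h2
        exact h2
      · rintro ⟨y, h1, h2⟩
        refine ⟨y - p * (x / p), by have := red x; omega, ?_⟩
        rw [hS.per_mul (x / p), red]
        simpa using h2

/-- noncrossing equivalence relations on the `2m`-cycle (lifted to the integers) that are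
invariant under the shift by `p` -/
structure IsM1 (p m : ℤ) (R : ℤ → ℤ → Prop) : Prop where
  refl : ∀ x, R x x
  symm : ∀ {x y}, R x y → R y x
  trans : ∀ {x y z}, R x y → R y z → R x z
  per : ∀ x y, R x y ↔ R (x + p) (y + p)
  wrap : ∀ x, R x (x + 2 * m)
  nc : ∀ {x y z t}, x < y → y < z → z < t → t < x + 2 * m → R x z → R y t → R x y

lemma shift_mul {p : ℤ} {R : ℤ → ℤ → Prop} (h : ∀ x y, R x y ↔ R (x + p) (y + p)) (j x y : ℤ) :
    R x y ↔ R (x + p * j) (y + p * j) := by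
  induction j using Int.induction_on with
  | zero => simp
  | succ i ih =>
    rw [ih, h]
    ring_nf
  | pred i ih =>
    rw [ih, h (x + p * (-↑i - 1))]
    ring_nf

lemma step_mul {p : ℤ} {R : ℤ → ℤ → Prop} (hr : ∀ x, R x x) (hs : ∀ {x y}, R x y → R y x)
    (ht : ∀ {x y z}, R x y → R y z → R x z) (h : ∀ x y, R x y ↔ R (x + p) (y + p)) (x : ℤ)
    (hx : R x (x + p)) (j : ℤ) : R x (x + p * j) := by
  induction j using Int.induction_on with
  | zero => simpa using hr x
  | succ i ih =>
    refine ht ih ?_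
    have := (shift_mul h i _ _).1 hx
    ring_nf at this ⊢; exact this
  | pred i ih =>
    refine ht ih (hs ?_)
    have := (shift_mul h (-i - 1) _ _).1 hx
    ring_nf at this ⊢; exact this

lemma IsM1.step {p m : ℤ} {R : ℤ → ℤ → Prop} (hR : IsM1 p m R) {x : ℤ} (hx : R x (x + p)) (j : ℤ) :
    R x (x + p * j) := step_mul hR.refl hR.symm hR.trans hR.per x hx j

lemma IsM2.step {p : ℤ} {R : ℤ → ℤ → Prop} (hR : IsM2 p R) {x : ℤ} (hx : R x (x + p)) (j : ℤ) :
    R x (x + p * j) := step_mul hR.refl hR.symm hR.trans hR.per x hx j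

lemma IsM1.wrap_mul {p m : ℤ} {R : ℤ → ℤ → Prop} (hR : IsM1 p m R) (x j : ℤ) :
    R x (x + 2 * m * j) := by
  refine step_mul (p := 2 * m) hR.refl hR.symm hR.trans ?_ x (hR.wrap x) j
  intro x y
  exact ⟨fun h => hR.trans (hR.symm (hR.wrap x)) (hR.trans h (hR.wrap y)),
    fun h => hR.trans (hR.wrap x) (hR.trans h (hR.symm (hR.wrap y)))⟩

lemma IsM1.central {p m : ℤ} {R : ℤ → ℤ → Prop} (hR : IsM1 p m R) {x y : ℤ} (h : R x y)
    (hx : R x (x + p)) : R y (y + p) :=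
  hR.trans (hR.symm h) (hR.trans hx ((hR.per _ _).1 h))

lemma IsM2.central {p : ℤ} {R : ℤ → ℤ → Prop} (hR : IsM2 p R) {x y : ℤ} (h : R x y)
    (hx : R x (x + p)) : R y (y + p) :=
  hR.trans (hR.symm h) (hR.trans hx ((hR.per _ _).1 h))

lemma IsM1.far {p m : ℤ} (hp : 0 < p) {R : ℤ → ℤ → Prop} (hR : IsM1 p m R) {x y : ℤ} (h : R x y)
    (h1 : p ≤ |x - y|) (h2 : |x - y| ≤ 2 * m - p) : R x (x + p) := by
  have main : ∀ x y, R x y → x < y → p ≤ y - x → y - x ≤ 2 * m - p → R x (x + p) := by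
    intro x y h hlt h1 h2
    rcases eq_or_lt_of_le h1 with h1 | h1
    · have : x + p = y := by omega
      rw [this]; exact h
    rcases eq_or_lt_of_le h2 with h2 | h2
    · have e : y + p = x + 2 * m := by omega
      have a := (hR.per _ _).1 h
      rw [e] at a
      exact hR.symm (hR.trans a (hR.symm (hR.wrap x)))
    · exact hR.nc (show x < x + p by omega) (show x + p < y by omega) (show y < y + p by omega)
        (by omega) h ((hR.per _ _).1 h)
  rcases lt_trichotomy x y with hlt | rfl | hlt
  · rw [abs_of_neg (by omega)] at h1 h2
    exact main x y h hlt (by omega) (by omega)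
  · simp at h1; omega
  · rw [abs_of_pos (by omega)] at h1 h2
    exact hR.central (hR.symm h) (main y x (hR.symm h) hlt (by omega) (by omega))

lemma IsM2.far {p : ℤ} (hp : 0 < p) {R : ℤ → ℤ → Prop} (hR : IsM2 p R) {x y : ℤ} (h : R x y)
    (h1 : p ≤ |x - y|) : R x (x + p) := by
  have main : ∀ x y, R x y → x < y → p ≤ y - x → R x (x + p) := by
    intro x y h hlt h1
    rcases eq_or_lt_of_le h1 with h1 | h1
    · have : x + p = y := by omega
      rw [this]; exact h
    · exact hR.nc (show x < x + p by omega) (show x + p < y by omega) (show y < y + p by omega)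
        h ((hR.per _ _).1 h)
  rcases lt_trichotomy x y with hlt | rfl | hlt
  · rw [abs_of_neg (by omega)] at h1
    exact main x y h hlt (by omega)
  · simp at h1; omega
  · rw [abs_of_pos (by omega)] at h1
    exact hR.central (hR.symm h) (main y x (hR.symm h) hlt (by omega))

lemma exists_rep (p x y : ℤ) (hp : 0 < p) : ∃ j, x + p * j ≤ y ∧ y < x + p * j + p :=
  ⟨(y - x) / p, by
    have h1 := Int.emod_add_mul_ediv (y - x) p
    have h2 := Int.emod_nonneg (y - x) hp.ne'
    have h3 := Int.emod_lt_of_pos (y - x) hp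
    constructor <;> linarith⟩

lemma IsM1.two_central {p m : ℤ} (hp : 0 < p) (hm : 3 * p ≤ m) {R : ℤ → ℤ → Prop}
    (hR : IsM1 p m R) {x y : ℤ} (hx : R x (x + p)) (hy : R y (y + p)) : R x y := by
  obtain ⟨j, h1, h2⟩ := exists_rep p x y hp
  have a := hR.step hx j
  refine hR.trans a ?_
  rcases eq_or_lt_of_le h1 with h1 | h1
  · rw [h1]; exact hR.refl _
  · exact hR.nc h1 h2 (show _ < y + p by omega) (by omega) (hR.central a hx) hy

lemma IsM2.two_central {p : ℤ} (hp : 0 < p) {R : ℤ → ℤ → Prop}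
    (hR : IsM2 p R) {x y : ℤ} (hx : R x (x + p)) (hy : R y (y + p)) : R x y := by
  obtain ⟨j, h1, h2⟩ := exists_rep p x y hp
  have a := hR.step hx j
  refine hR.trans a ?_
  rcases eq_or_lt_of_le h1 with h1 | h1
  · rw [h1]; exact hR.refl _
  · exact hR.nc h1 h2 (show _ < y + p by omega) (hR.central a hx) hy

/-- from cyclic to linear -/
def toS (p : ℤ) (R : ℤ → ℤ → Prop) (x y : ℤ) : Prop := R x y ∧ (|x - y| < p ∨ R x (x + p))

/-- from linear to cyclic -/
def toR (m : ℤ) (S : ℤ → ℤ → Prop) (x y : ℤ) : Prop := ∃ j, S x (y + 2 * m * j)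

lemma toS_isM2 {p m : ℤ} (hp : 0 < p) (hm : 3 * p ≤ m) {R : ℤ → ℤ → Prop} (hR : IsM1 p m R) :
    IsM2 p (toS p R) := by
  refine ⟨?_, ?_, ?_, ?_, ?_⟩
  · intro x
    exact ⟨hR.refl x, Or.inl (by simpa using hp)⟩
  · rintro x y ⟨h1, h2⟩
    refine ⟨hR.symm h1, ?_⟩
    rcases h2 with h2 | h2
    · left; rwa [abs_sub_comm]
    · right; exact hR.central h1 h2
  · rintro x y z ⟨h1, h2⟩ ⟨h3, h4⟩
    refine ⟨hR.trans h1 h3, ?_⟩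
    rcases h2 with h2 | h2
    · rcases h4 with h4 | h4
      · by_cases hc : |x - z| < p
        · exact Or.inl hc
        · right
          refine hR.far hp (hR.trans h1 h3) (not_lt.1 hc) ?_
          rw [abs_lt] at h2 h4
          rw [abs_le]
          constructor <;> omega
      · exact Or.inr (hR.central (hR.symm h1) h4)
    · exact Or.inr h2
  · intro x y
    unfold toS
    have e : x + p - (y + p) = x - y := by ring
    rw [e, ← hR.per, ← hR.per]
  · rintro x y z t hxy hyz hzt ⟨h1, h2⟩ ⟨h3, h4⟩
    rcases h2 with h2 | h2
    · have hxp : |x - y| < p := by rw [abs_lt] at h2 ⊢; constructor <;> omega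
      refine ⟨?_, Or.inl hxp⟩
      rcases h4 with h4 | h4
      · rw [abs_lt] at h2 h4
        exact hR.nc hxy hyz hzt (by omega) h1 h3
      · rw [abs_lt] at h2
        exact hR.nc hxy hyz (show z < y + p by omega) (by omega) h1 h4
    · refine ⟨?_, Or.inr h2⟩
      rcases h4 with h4 | h4
      · obtain ⟨j, g1, g2⟩ := exists_rep p x y hp
        have a := hR.step h2 j
        refine hR.trans a ?_
        rcases eq_or_lt_of_le g1 with g1 | g1
        · rw [g1]; exact hR.refl _
        · rw [abs_lt] at h4
          exact hR.nc g1 hyz hzt (by omega) (hR.trans (hR.symm a) h1) h3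
      · exact hR.two_central hp hm h2 h4

lemma toR_isM1 {p m : ℤ} (hp : 0 < p) (hm : 3 * p ≤ m) (hd : p ∣ m) {S : ℤ → ℤ → Prop}
    (hS : IsM2 p S) : IsM1 p m (toR m S) := by
  obtain ⟨d, rfl⟩ := hd
  have sh : ∀ j x y, S x y ↔ S (x + 2 * (p * d) * j) (y + 2 * (p * d) * j) := by
    intro j x y
    have := hS.per_mul (2 * d * j) x y
    have e : p * (2 * d * j) = 2 * (p * d) * j := by ring
    rwa [e] at this
  have cen : ∀ x, S x (x + p) → ∀ j, S x (x + 2 * (p * d) * j) := by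
    intro x hx j
    have := hS.step hx (2 * d * j)
    have e : p * (2 * d * j) = 2 * (p * d) * j := by ring
    rwa [e] at this
  generalize p * d = m at *
  have hsymm : ∀ {x y}, toR m S x y → toR m S y x := by
    rintro x y ⟨j, hj⟩
    refine ⟨-j, ?_⟩
    have := (sh (-j) _ _).1 (hS.symm hj)
    ring_nf at this ⊢; exact this
  have htrans : ∀ {x y z}, toR m S x y → toR m S y z → toR m S x z := by
    rintro x y z ⟨j, hj⟩ ⟨i, hi⟩
    refine ⟨i + j, ?_⟩
    have := hS.trans hj ((sh j _ _).1 hi)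
    ring_nf at this ⊢; exact this
  refine ⟨?_, hsymm, htrans, ?_, ?_, ?_⟩
  · intro x
    exact ⟨0, by simpa using hS.refl x⟩
  · intro x y
    unfold toR
    refine exists_congr fun j => ?_
    rw [hS.per]
    have e : y + 2 * m * j + p = y + p + 2 * m * j := by ring
    rw [e]
  · intro x
    exact ⟨-1, by
      have e : x + 2 * m + 2 * m * -1 = x := by ring
      rw [e]; exact hS.refl x⟩
  · rintro x y z t hxy hyz hzt htx ⟨j, hj⟩ ⟨i, hi⟩
    have ofS : ∀ {x y}, S x y → toR m S x y := fun {x y} h => ⟨0, by simpa using h⟩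
    -- normalise both exponents
    have norm : ∀ x z j, x < z → z < x + 2 * m → S x (z + 2 * m * j) →
        S x z ∨ S z (x + 2 * m) := by
      intro x z j h1 h2 h3
      by_cases hc : |x - (z + 2 * m * j)| < p
      · rw [abs_lt] at hc
        have j1 : j < 1 := by by_contra hj; nlinarith
        have j2 : -2 < j := by by_contra hj; nlinarith
        have : j = 0 ∨ j = -1 := by omega
        rcases this with rfl | rfl
        · left; simpa using h3
        · right
          have := (sh 1 _ _).1 (hS.symm h3)
          ring_nf at this ⊢; exact this
      · left
        have a := cen _ (hS.central h3 (hS.far hp h3 (not_lt.1 hc))) (-j)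
        have e : z + 2 * m * j + 2 * m * (-j) = z := by ring
        rw [e] at a
        exact hS.trans h3 a
    have wr : ∀ {x y}, S x (y + 2 * m) → toR m S x y := fun {x y} h => ⟨1, by simpa using h⟩
    have sh1 : ∀ {x y}, S x (y + 2 * m) → S (x - 2 * m) y := fun {x y} h => by
      have := (sh (-1) _ _).1 h
      ring_nf at this ⊢; exact this
    have nx := norm x z j (by omega) (by omega) hj
    have ny := norm y t i (by omega) (by omega) hi
    rcases nx with nx | nx
    · rcases ny with ny | ny
      · exact ofS (hS.nc hxy hyz hzt nx ny)
      · have a := hS.nc (show t - 2 * m < x by omega) hxy hyz (sh1 ny) nx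
        exact ofS (hS.trans (hS.symm a) (sh1 ny))
    · rcases ny with ny | ny
      · have a := hS.nc hyz hzt htx ny nx
        exact hsymm (wr (hS.trans a nx))
      · have a := hS.nc hzt htx (show x + 2 * m < y + 2 * m by omega) nx ny
        exact ofS ((sh 1 _ _).2 (by
          have := hS.trans (hS.symm nx) (hS.trans a ny)
          simpa using this))

lemma toR_toS {p m : ℤ} (hp : 0 < p) (hm : 3 * p ≤ m) {R : ℤ → ℤ → Prop} (hR : IsM1 p m R) :
    toR m (toS p R) = R := by
  funext x y
  apply propext
  constructor
  · rintro ⟨j, h1, -⟩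
    exact hR.trans h1 (hR.symm (hR.wrap_mul y j))
  · intro h
    obtain ⟨j, h1, h2⟩ := exists_rep (2 * m) y (x + m) (by omega)
    have h3 := hR.trans h (hR.wrap_mul y j)
    refine ⟨j, h3, ?_⟩
    by_cases hc : |x - (y + 2 * m * j)| < p
    · exact Or.inl hc
    · right
      refine hR.far hp h3 (not_lt.1 hc) ?_
      rw [abs_le]
      constructor <;> linarith

lemma toS_toR {p m : ℤ} (hp : 0 < p) (hm : 3 * p ≤ m) (hd : p ∣ m) {S : ℤ → ℤ → Prop}
    (hS : IsM2 p S) : toS p (toR m S) = S := by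
  have key : ∀ x y j, S x (y + 2 * m * j) → p ≤ |x - (y + 2 * m * j)| → S x y ∧ S x (x + p) := by
    intro x y j h1 h2
    have a := hS.far hp h1 h2
    refine ⟨hS.trans h1 ?_, a⟩
    obtain ⟨d, rfl⟩ := hd
    have := hS.step (hS.central h1 a) (- (2 * d * j))
    ring_nf at this ⊢; exact this
  funext x y
  apply propext
  constructor
  · rintro ⟨⟨j, h1⟩, h2⟩
    by_cases hc : |x - (y + 2 * m * j)| < p
    · rcases h2 with h2 | ⟨i, h2⟩
      · rw [abs_lt] at hc h2
        have j1 : j < 1 := by by_contra hj; nlinarith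
        have j2 : -1 < j := by by_contra hj; nlinarith
        have : j = 0 := by omega
        subst this
        simpa using h1
      · have h3 : S x (x + p) := by
          refine (key x (x + p) i h2 ?_).2
          rw [le_abs]
          rcases lt_or_ge i 0 with hi | hi
          · left; nlinarith
          · right; nlinarith
        refine hS.trans h1 ?_
        obtain ⟨d, rfl⟩ := hd
        have := hS.step (hS.central h1 h3) (- (2 * d * j))
        ring_nf at this ⊢; exact this
    · exact (key x y j h1 (not_lt.1 hc)).1
  · intro h
    refine ⟨⟨0, by simpa using h⟩, ?_⟩
    by_cases hc : |x - y| < p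
    · exact Or.inl hc
    · exact Or.inr ⟨0, by simpa using hS.far hp h (not_lt.1 hc)⟩

lemma M1_card (p : ℕ) (m : ℤ) (hp : 0 < p) (hm : 3 * (p : ℤ) ≤ m) (hd : (p : ℤ) ∣ m) :
    Nat.card {R : ℤ → ℤ → Prop // IsM1 p m R} = (2 * p).choose p := by
  have hp' : (0:ℤ) < p := by exact_mod_cast hp
  rw [← M2_card p hp]
  exact Nat.card_congr
    { toFun := fun R => ⟨toS p R.1, toS_isM2 hp' hm R.2⟩
      invFun := fun S => ⟨toR m S.1, toR_isM1 hp' hm hd S.2⟩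
      left_inv := fun R => Subtype.ext (toR_toS hp' hm R.2)
      right_inv := fun S => Subtype.ext (toS_toR hp' hm hd S.2) }

/-- position `k` on the circle -/
noncomputable def Qpt (m k : ℤ) : ℝ × ℝ :=
  (Real.cos (Real.pi * k / m), -Real.sin (Real.pi * k / m))

/-- orientation determinant -/
def Det (X Y Z : ℝ × ℝ) : ℝ :=
  (Y.2 - X.2) * (Z.1 - X.1) - (Y.1 - X.1) * (Z.2 - X.2)

lemma Det_Qpt (m a b c : ℤ) : Det (Qpt m a) (Qpt m b) (Qpt m c) =
    4 * Real.sin ((Real.pi * b / m - Real.pi * a / m) / 2) *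
      Real.sin ((Real.pi * c / m - Real.pi * a / m) / 2) *
      Real.sin ((Real.pi * c / m - Real.pi * b / m) / 2) := by
  generalize ha : Real.pi * a / m = α
  generalize hb : Real.pi * b / m = β
  generalize hc : Real.pi * c / m = γ
  simp only [Det, Qpt, ha, hb, hc]
  have e : Real.sin ((γ - β) / 2) = Real.sin ((γ + α) / 2) * Real.cos ((β + α) / 2) -
      Real.cos ((γ + α) / 2) * Real.sin ((β + α) / 2) := by
    rw [← Real.sin_sub]; congr 1; ring
  have h1 := Real.sin_sub_sin β α
  have h2 := Real.sin_sub_sin γ α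
  have h3 := Real.cos_sub_cos β α
  have h4 := Real.cos_sub_cos γ α
  rw [e]
  have e1 : -Real.sin β - -Real.sin α = -(Real.sin β - Real.sin α) := by ring
  have e2 : -Real.sin γ - -Real.sin α = -(Real.sin γ - Real.sin α) := by ring
  rw [e1, e2, h1, h2, h3, h4]
  ring

lemma Det_pos (m a b c : ℤ) (hm : 0 < m) (hab : a < b) (hbc : b < c) (hca : c < a + 2 * m) :
    0 < Det (Qpt m a) (Qpt m b) (Qpt m c) := by
  have hm' : (0:ℝ) < m := by exact_mod_cast hm
  have key : ∀ a b : ℤ, a < b → b < a + 2 * m →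
      0 < Real.sin ((Real.pi * b / m - Real.pi * a / m) / 2) := by
    intro a b h1 h2
    have h1' : (a:ℝ) < b := by exact_mod_cast h1
    have h2' : (b:ℝ) < a + 2 * m := by exact_mod_cast h2
    have e : (Real.pi * b / m - Real.pi * a / m) / 2 = Real.pi * ((b - a) / (2 * m)) := by
      field_simp
    rw [e]
    apply Real.sin_pos_of_pos_of_lt_pi
    · exact mul_pos Real.pi_pos (div_pos (by linarith) (by linarith))
    · have : (b - a) / (2 * m) < (1:ℝ) := by rw [div_lt_one (by linarith)]; linarith
      nlinarith [Real.pi_pos]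
  rw [Det_Qpt]
  have h1 := key a b hab (by omega)
  have h2 := key a c (by omega) (by omega)
  have h3 := key b c hbc (by omega)
  positivity

lemma lin_form (f : ℝ × ℝ →L[ℝ] ℝ) (v : ℝ × ℝ) : f v = v.1 * f (1, 0) + v.2 * f (0, 1) := by
  have : v = v.1 • ((1:ℝ), (0:ℝ)) + v.2 • ((0:ℝ), (1:ℝ)) := by ext <;> simp
  calc f v = f (v.1 • ((1:ℝ), (0:ℝ)) + v.2 • ((0:ℝ), (1:ℝ))) := congrArg f this
    _ = _ := by
      rw [map_add, map_smul, map_smul]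
      simp only [smul_eq_mul]

lemma cross_of_order {X Y Z T : ℝ × ℝ} (h1 : 0 < Det X Y Z) (h2 : 0 < Det X Z T)
    (h3 : 0 < Det X Y T) (h4 : 0 < Det Y Z T) {A A' : Set (ℝ × ℝ)} (hX : X ∈ A) (hZ : Z ∈ A)
    (hY : Y ∈ A') (hT : T ∈ A') :
    ∃ v ∈ convexHull ℝ A', v ∈ intrinsicInterior ℝ (convexHull ℝ A) := by
  have hsum : Det X Z T + Det X Y Z = Det Y Z T + Det X Y T := by simp only [Det]; ring
  have id1 : Det X Z T * Y.1 + Det X Y Z * T.1 = Det Y Z T * X.1 + Det X Y T * Z.1 := by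
    simp only [Det]; ring
  have id2 : Det X Z T * Y.2 + Det X Y Z * T.2 = Det Y Z T * X.2 + Det X Y T * Z.2 := by
    simp only [Det]; ring
  have sX := subset_convexHull ℝ A hX
  have sZ := subset_convexHull ℝ A hZ
  have sY := subset_convexHull ℝ A' hY
  have sT := subset_convexHull ℝ A' hT
  by_cases hcol : ∀ u ∈ A, Det X Z u = 0
  · -- all points of `A` are on the line through `X` and `Z`
    set w := Det X Z T + Det X Y Z with hw
    have hwpos : 0 < w := by positivity
    set q : ℝ × ℝ := (Det X Z T / w) • Y + (Det X Y Z / w) • T with hq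
    have hqC' : q ∈ convexHull ℝ A' := by
      apply (convex_convexHull ℝ A') sY sT (by positivity) (by positivity)
      rw [← add_div]; exact div_self hwpos.ne'
    have hq' : q = (Det Y Z T / w) • X + (Det X Y T / w) • Z := by
      ext
      · simp only [hq, Prod.fst_add, Prod.smul_fst, smul_eq_mul]
        field_simp
        linarith
      · simp only [hq, Prod.snd_add, Prod.smul_snd, smul_eq_mul]
        field_simp
        linarith
    have hqC : q ∈ convexHull ℝ A := by
      rw [hq']
      apply (convex_convexHull ℝ A) sX sZ (by positivity) (by positivity)
      rw [← add_div, ← hsum]; exact div_self hwpos.ne'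
    refine ⟨q, hqC', ?_⟩
    have hspan : ∀ v ∈ affineSpan ℝ (convexHull ℝ A), Det X Z v = 0 := by
      intro v hv
      rw [affineSpan_convexHull] at hv
      refine affineSpan_induction (p := fun v => Det X Z v = 0) hv hcol ?_
      intro c u v w hu hv hw
      simp only [Det, vsub_eq_sub, vadd_eq_add, Prod.fst_add, Prod.snd_add, Prod.smul_fst,
        Prod.smul_snd, Prod.fst_sub, Prod.snd_sub, smul_eq_mul] at hu hv hw ⊢
      linear_combination c * hu - c * hv + hw
    rw [mem_intrinsicInterior]
    refine ⟨⟨q, subset_affineSpan ℝ _ hqC⟩, ?_, rfl⟩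
    rw [mem_interior]
    set g : ℝ × ℝ → ℝ := fun v => (v.1 - X.1) * (Z.1 - X.1) + (v.2 - X.2) * (Z.2 - X.2) with hg
    set N : ℝ := (Z.1 - X.1) ^ 2 + (Z.2 - X.2) ^ 2 with hN
    have hNpos : 0 < N := by
      by_contra hc
      have e1 : Z.1 - X.1 = 0 := by nlinarith [sq_nonneg (Z.1 - X.1), sq_nonneg (Z.2 - X.2)]
      have e2 : Z.2 - X.2 = 0 := by nlinarith [sq_nonneg (Z.1 - X.1), sq_nonneg (Z.2 - X.2)]
      simp only [Det, e1, e2] at h1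
      simp at h1
    have hgc : Continuous g := by fun_prop
    refine ⟨{v | 0 < g v.1} ∩ {v | g v.1 < N}, ?_, ?_, ?_⟩
    · rintro ⟨v, hv⟩ ⟨hv1, hv2⟩
      have hd := hspan v hv
      simp only [Set.mem_ofPred_eq] at hv1 hv2
      show v ∈ convexHull ℝ A
      have e : v = (1 - g v / N) • X + (g v / N) • Z := by
        simp only [Det] at hd
        ext
        · simp only [Prod.fst_add, Prod.smul_fst, smul_eq_mul]
          field_simp
          simp only [hg, hN]
          linear_combination (Z.2 - X.2) * hd
        · simp only [Prod.snd_add, Prod.smul_snd, smul_eq_mul]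
          field_simp
          simp only [hg, hN]
          linear_combination (-(Z.1 - X.1)) * hd
      rw [e]
      have : g v / N ≤ 1 := by rw [div_le_one hNpos]; exact hv2.le
      exact (convex_convexHull ℝ A) sX sZ (by linarith) (by positivity) (by ring)
    · apply IsOpen.inter
      · exact isOpen_lt continuous_const (hgc.comp continuous_subtype_val)
      · exact isOpen_lt (hgc.comp continuous_subtype_val) continuous_const
    · have hgq : g q = (Det X Y T / w) * N := by
        have hs : Det Y Z T / w = 1 - Det X Y T / w := by
          rw [eq_sub_iff_add_eq, ← add_div, ← hsum]; exact div_self hwpos.ne'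
        rw [hq', hs]
        simp only [hg, hN, Prod.fst_add, Prod.snd_add, Prod.smul_fst, Prod.smul_snd, smul_eq_mul]
        ring
      have hlt : Det X Y T / w < 1 := by rw [div_lt_one hwpos]; linarith
      constructor
      · show 0 < g q
        rw [hgq]; positivity
      · show g q < N
        rw [hgq]; nlinarith
  · push Not at hcol
    obtain ⟨u, huA, hu⟩ := hcol
    have hspan : affineSpan ℝ A = ⊤ := by
      rw [eq_top_iff]
      intro v _
      have mX := subset_affineSpan ℝ A hX
      have mZ := subset_affineSpan ℝ A hZ
      have mU := subset_affineSpan ℝ A huA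
      have dZ := AffineSubspace.vsub_mem_direction mZ mX
      have dU := AffineSubspace.vsub_mem_direction mU mX
      have e : v = ((Det X v u / Det X Z u) • (Z -ᵥ X) + (Det X Z v / Det X Z u) • (u -ᵥ X))
          +ᵥ X := by
        ext
        · simp only [vsub_eq_sub, vadd_eq_add, Prod.fst_add, Prod.smul_fst, Prod.fst_sub,
            smul_eq_mul]
          field_simp
          simp only [Det]; ring
        · simp only [vsub_eq_sub, vadd_eq_add, Prod.snd_add, Prod.smul_snd, Prod.snd_sub,
            smul_eq_mul]
          field_simp
          simp only [Det]; ring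
      rw [e]
      exact AffineSubspace.vadd_mem_of_mem_direction
        (Submodule.add_mem _ (Submodule.smul_mem _ _ dZ) (Submodule.smul_mem _ _ dU)) mX
    have hne : (interior (convexHull ℝ A)).Nonempty :=
      interior_convexHull_nonempty_iff_affineSpan_eq_top.2 hspan
    by_contra hcon
    push Not at hcon
    have hdisj : Disjoint (interior (convexHull ℝ A)) (convexHull ℝ A') := by
      rw [Set.disjoint_left]
      intro v hv hv'
      exact hcon v hv' (interior_subset_intrinsicInterior hv)
    obtain ⟨f, c, hf1, hf2⟩ := geometric_hahn_banach_open (convex_convexHull ℝ A).interior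
      isOpen_interior (convex_convexHull ℝ A') hdisj
    have hcl : convexHull ℝ A ⊆ {v | f v ≤ c} := by
      have h5 : closure (interior (convexHull ℝ A)) ⊆ {v | f v ≤ c} :=
        closure_minimal (fun v hv => (hf1 v hv).le) (isClosed_le f.continuous continuous_const)
      rw [(convex_convexHull ℝ A).closure_interior_eq_closure_of_nonempty_interior hne] at h5
      exact subset_closure.trans h5
    have fX : f X ≤ c := hcl sX
    have fZ : f Z ≤ c := hcl sZ
    have fY := hf2 Y sY
    have fT := hf2 T sT
    have idf : Det X Z T * f Y + Det X Y Z * f T = Det Y Z T * f X + Det X Y T * f Z := by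
      rw [lin_form f X, lin_form f Y, lin_form f Z, lin_form f T]
      linear_combination f (1, 0) * id1 + f (0, 1) * id2
    have k1 := mul_nonneg h2.le (sub_nonneg.2 fY)
    have k2 := mul_nonneg h1.le (sub_nonneg.2 fT)
    have k3 := mul_nonneg h4.le (sub_nonneg.2 fX)
    have k4 := mul_nonneg h3.le (sub_nonneg.2 fZ)
    have ks : Det X Z T * (f Y - c) + Det X Y Z * (f T - c) + Det Y Z T * (c - f X) +
        Det X Y T * (c - f Z) = 0 := by linear_combination idf - c * hsum
    have eX : f X = c := by
      have h0 : Det Y Z T * (c - f X) = 0 := by linarith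
      have := (mul_eq_zero.1 h0).resolve_left h4.ne'
      linarith
    have eZ : f Z = c := by
      have h0 : Det X Y T * (c - f Z) = 0 := by linarith
      have := (mul_eq_zero.1 h0).resolve_left h3.ne'
      linarith
    have eY : f Y = c := by
      have h0 : Det X Z T * (f Y - c) = 0 := by linarith
      have := (mul_eq_zero.1 h0).resolve_left h2.ne'
      linarith
    rw [lin_form] at eX eY eZ
    have z1 : f (1, 0) * Det X Y Z = 0 := by
      simp only [Det]
      linear_combination (Y.2 - X.2) * (eZ - eX) - (Z.2 - X.2) * (eY - eX)
    have z2 : f (0, 1) * Det X Y Z = 0 := by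
      simp only [Det]
      linear_combination -(Y.1 - X.1) * (eZ - eX) + (Z.1 - X.1) * (eY - eX)
    have z1' : f (1, 0) = 0 := by
      rcases mul_eq_zero.1 z1 with h | h
      · exact h
      · linarith
    have z2' : f (0, 1) = 0 := by
      rcases mul_eq_zero.1 z2 with h | h
      · exact h
      · linarith
    obtain ⟨v, hv⟩ := hne
    have := hf1 v hv
    rw [lin_form, z1', z2'] at this
    rw [z1', z2'] at eX
    linarith

lemma hull_lt {f : ℝ × ℝ →ₗ[ℝ] ℝ} {c : ℝ} {A : Set (ℝ × ℝ)} (h : ∀ v ∈ A, f v < c) :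
    ∀ v ∈ convexHull ℝ A, f v < c := by
  have : convexHull ℝ A ⊆ {v | f v < c} :=
    convexHull_min h (convex_halfSpace_lt f.isLinear c)
  exact this

lemma hull_le {f : ℝ × ℝ →ₗ[ℝ] ℝ} {c : ℝ} {A : Set (ℝ × ℝ)} (h : ∀ v ∈ A, f v ≤ c) :
    ∀ v ∈ convexHull ℝ A, f v ≤ c := by
  have : convexHull ℝ A ⊆ {v | f v ≤ c} :=
    convexHull_min h (convex_halfSpace_le f.isLinear c)
  exact this

lemma hull_gt {f : ℝ × ℝ →ₗ[ℝ] ℝ} {c : ℝ} {A : Set (ℝ × ℝ)} (h : ∀ v ∈ A, c < f v) :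
    ∀ v ∈ convexHull ℝ A, c < f v := by
  have : convexHull ℝ A ⊆ {v | c < f v} :=
    convexHull_min h (convex_halfSpace_gt f.isLinear c)
  exact this

/-- the functional pairing with a direction -/
noncomputable def fdir (α : ℝ) : ℝ × ℝ →ₗ[ℝ] ℝ :=
  Real.cos α • LinearMap.fst ℝ ℝ ℝ - Real.sin α • LinearMap.snd ℝ ℝ ℝ

lemma fdir_Qpt (α : ℝ) (m k : ℤ) : fdir α (Qpt m k) = Real.cos (Real.pi * k / m - α) := by
  simp [fdir, Qpt, Real.cos_sub]
  ring

lemma Qpt_not_mem_hull (m y : ℤ) (hm : 0 < m) (A : Set (ℝ × ℝ))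
    (hA : ∀ v ∈ A, v = (0, 0) ∨ ∃ k, v = Qpt m k ∧ ¬ (2 * m ∣ k - y)) :
    Qpt m y ∉ convexHull ℝ A := by
  intro hmem
  have hm' : (m:ℝ) ≠ 0 := by exact_mod_cast hm.ne'
  have h := hull_lt (f := fdir (Real.pi * y / m)) (c := 1) (A := A) ?_ _ hmem
  · rw [fdir_Qpt] at h; simp at h
  · intro v hv
    rcases hA v hv with rfl | ⟨k, rfl, hk⟩
    · simp [fdir]
    · rw [fdir_Qpt]
      refine lt_of_le_of_ne (Real.cos_le_one _) ?_
      intro hc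
      rw [Real.cos_eq_one_iff] at hc
      obtain ⟨j, hj⟩ := hc
      apply hk
      refine ⟨j, ?_⟩
      field_simp at hj
      have h2 : ((j * 2 * m : ℤ) : ℝ) = ((k - y : ℤ) : ℝ) := by
        push_cast
        nlinarith [Real.pi_pos]
      have h3 : j * 2 * m = k - y := by exact_mod_cast h2
      linarith

lemma hull_disj (m a b : ℤ) (hm : 0 < m) (hab : a ≤ b) (hb : b - a < m) (A A' : Set (ℝ × ℝ))
    (hA : ∀ v ∈ A, ∃ k, v = Qpt m k ∧ a ≤ k ∧ k ≤ b)
    (hA' : ∀ v ∈ A', v = (0, 0) ∨ ∃ k, v = Qpt m k ∧ b < k ∧ k < a + 2 * m) :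
    Disjoint (convexHull ℝ A) (convexHull ℝ A') := by
  have hm' : (0:ℝ) < m := by exact_mod_cast hm
  have hab' : (a:ℝ) ≤ b := by exact_mod_cast hab
  have hb' : (b:ℝ) - a + 1 ≤ m := by exact_mod_cast (by omega : b - a + 1 ≤ m)
  set φ := Real.pi * ((b - a + 1) / (2 * m)) with hφ
  have hr : ((b:ℝ) - a + 1) / (2 * m) ≤ 1 / 2 := by
    rw [div_le_iff₀ (by linarith)]; linarith
  have hr0 : 0 < ((b:ℝ) - a + 1) / (2 * m) := div_pos (by linarith) (by linarith)
  have hφ1 : φ ≤ Real.pi / 2 := by rw [hφ]; nlinarith [Real.pi_pos]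
  have hφ0 : 0 < φ := mul_pos Real.pi_pos hr0
  have hc0 : 0 ≤ Real.cos φ := Real.cos_nonneg_of_neg_pi_div_two_le_of_le (by linarith) hφ1
  have earg : ∀ k : ℤ, Real.pi * k / m - Real.pi * ((a + b) / (2 * m)) =
      Real.pi * ((2 * k - a - b) / (2 * m)) := by
    intro k; field_simp; ring
  rw [Set.disjoint_left]
  intro v hv hv'
  have h1 := hull_gt (f := fdir (Real.pi * ((a + b) / (2 * m)))) (c := Real.cos φ) (A := A) ?_ v hv
  · have h2 := hull_le (f := fdir (Real.pi * ((a + b) / (2 * m)))) (c := Real.cos φ) (A := A')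
      ?_ v hv'
    · linarith
    · intro u hu
      rcases hA' u hu with rfl | ⟨k, rfl, hk1, hk2⟩
      · simpa [fdir] using hc0
      · rw [fdir_Qpt, earg]
        have k1 : (b:ℝ) + 1 ≤ k := by exact_mod_cast hk1
        have k2 : (k:ℝ) + 1 ≤ a + 2 * m := by exact_mod_cast hk2
        have l1 : φ ≤ Real.pi * ((2 * k - a - b) / (2 * m)) := by
          rw [hφ]; gcongr; linarith
        have l2 : Real.pi * ((2 * k - a - b) / (2 * m)) ≤ 2 * Real.pi - φ := by
          have : φ + Real.pi * ((2 * k - a - b) / (2 * m)) =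
              Real.pi * ((2 * k - 2 * a + 1) / (2 * m)) := by
            rw [hφ]; field_simp; ring
          have h3 : ((2 * k - 2 * a + 1) / (2 * m) : ℝ) ≤ 2 := by
            rw [div_le_iff₀ (by linarith)]; linarith
          nlinarith [Real.pi_pos]
        rcases le_total (Real.pi * ((2 * k - a - b) / (2 * m))) Real.pi with hle | hle
        · exact Real.cos_le_cos_of_nonneg_of_le_pi hφ0.le hle l1
        · rw [← Real.cos_two_pi_sub (Real.pi * ((2 * k - a - b) / (2 * m)))]
          exact Real.cos_le_cos_of_nonneg_of_le_pi hφ0.le (by linarith) (by linarith)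
  · intro u hu
    obtain ⟨k, rfl, hk1, hk2⟩ := hA u hu
    rw [fdir_Qpt, earg, ← Real.cos_abs (Real.pi * ((2 * k - a - b) / (2 * m)))]
    have k1 : (a:ℝ) ≤ k := by exact_mod_cast hk1
    have k2 : (k:ℝ) ≤ b := by exact_mod_cast hk2
    apply Real.cos_lt_cos_of_nonneg_of_le_pi (abs_nonneg _) (by linarith [Real.pi_pos])
    rw [hφ, abs_mul, abs_of_pos Real.pi_pos]
    gcongr
    rw [abs_div, abs_of_pos (by linarith : (0:ℝ) < 2 * m)]
    gcongr
    rw [abs_lt]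
    constructor <;> linarith

/-- the label at clockwise position `k` (taken modulo `2m`) -/
def lab (m k : ℤ) : ℤ := if k % (2 * m) < m then k % (2 * m) + 1 else m - 1 - k % (2 * m)

lemma lab_per (m k j : ℤ) : lab m (k + 2 * m * j) = lab m k := by
  simp [lab, Int.add_mul_emod_self_left]

lemma lab_lo (m r : ℤ) (h0 : 0 ≤ r) (h1 : r < m) : lab m r = r + 1 := by
  have : r % (2 * m) = r := Int.emod_eq_of_lt h0 (by omega)
  simp [lab, this, h1]

lemma lab_hi (m r : ℤ) (h0 : m ≤ r) (h1 : r < 2 * m) (hm : 0 < m) : lab m r = m - 1 - r := by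
  have : r % (2 * m) = r := Int.emod_eq_of_lt (by omega) (by omega)
  simp [lab, this, not_lt.2 h0]

lemma lab_rep (m k : ℤ) (hm : 0 < m) : ∃ r j, k = r + 2 * m * j ∧ 0 ≤ r ∧ r < 2 * m :=
  ⟨k % (2 * m), k / (2 * m), (Int.emod_add_mul_ediv k (2 * m)).symm,
    Int.emod_nonneg _ (by omega), Int.emod_lt_of_pos _ (by omega)⟩

lemma lab_cases (m k : ℤ) (hm : 0 < m) : ∃ r j, k = r + 2 * m * j ∧
    ((0 ≤ r ∧ r < m ∧ lab m k = r + 1) ∨ (m ≤ r ∧ r < 2 * m ∧ lab m k = m - 1 - r)) := by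
  obtain ⟨r, j, hk, h0, h1⟩ := lab_rep m k hm
  refine ⟨r, j, hk, ?_⟩
  rcases lt_or_ge r m with h | h
  · left
    refine ⟨h0, h, ?_⟩
    rw [hk, lab_per, lab_lo m r h0 h]
  · right
    refine ⟨h, h1, ?_⟩
    rw [hk, lab_per, lab_hi m r h h1 hm]

lemma lab_eq_iff (m k l : ℤ) (hm : 0 < m) : lab m k = lab m l ↔ ∃ j, l = k + 2 * m * j := by
  constructor
  · intro h
    obtain ⟨r, j, hk, hr⟩ := lab_cases m k hm
    obtain ⟨r', j', hk', hr'⟩ := lab_cases m l hm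
    have : r = r' := by omega
    refine ⟨j' - j, ?_⟩
    rw [hk, hk', this]; ring
  · rintro ⟨j, rfl⟩
    rw [lab_per]

lemma lab_add_m (m k : ℤ) (hm : 0 < m) : lab m (k + m) = - lab m k := by
  obtain ⟨r, j, hk, hr⟩ := lab_cases m k hm
  rcases hr with ⟨h1, h2, h3⟩ | ⟨h1, h2, h3⟩
  · rw [h3, hk, show r + 2 * m * j + m = (r + m) + 2 * m * j by ring, lab_per,
      lab_hi m _ (by omega) (by omega) hm]
    ring
  · rw [h3, hk, show r + 2 * m * j + m = (r - m) + 2 * m * (j + 1) by ring, lab_per,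
      lab_lo m _ (by omega) (by omega)]
    ring

lemma lab_abs (m k : ℤ) (hm : 0 < m) : 1 ≤ |lab m k| ∧ |lab m k| ≤ m := by
  obtain ⟨r, j, hk, hr⟩ := lab_cases m k hm
  rcases hr with ⟨h1, h2, h3⟩ | ⟨h1, h2, h3⟩
  · rw [h3, abs_of_pos (by omega)]; omega
  · rw [h3, abs_of_neg (by omega)]; omega

lemma lab_surj (m i : ℤ) (h1 : 1 ≤ |i|) (h2 : |i| ≤ m) : ∃ k, i = lab m k := by
  rcases abs_cases i with ⟨h, h'⟩ | ⟨h, h'⟩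
  · exact ⟨i - 1, by rw [lab_lo m _ (by omega) (by omega)]; ring⟩
  · exact ⟨m - 1 - i, by rw [lab_hi m _ (by omega) (by omega) (by omega)]; ring⟩

lemma rho_lab (n : ℕ) (hn : 4 ≤ n) (k : ℤ) :
    rhoFun n (lab ((n:ℤ) - 1) k) = lab ((n:ℤ) - 1) (k + 1) := by
  have hn' : (4:ℤ) ≤ n := by exact_mod_cast hn
  obtain ⟨m, hm⟩ : ∃ m : ℤ, m = (n:ℤ) - 1 := ⟨_, rfl⟩
  rw [← hm]
  obtain ⟨r, j, hk, hr⟩ := lab_cases m k (by omega)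
  rw [show k + 1 = (r + 1) + 2 * m * j by rw [hk]; ring, lab_per]
  unfold rhoFun
  rw [← hm]
  rcases hr with ⟨h1, h2, h3⟩ | ⟨h1, h2, h3⟩
  · rw [h3]
    by_cases h : r + 1 < m
    · rw [if_pos (by omega), lab_lo m _ (by omega) (by omega)]
    · rw [if_neg (by omega), if_pos (by omega), lab_hi m _ (by omega) (by omega) (by omega)]
      omega
  · rw [h3]
    by_cases h : r + 1 < 2 * m
    · rw [if_neg (by omega), if_neg (by omega), if_pos (by omega),
        lab_hi m _ (by omega) (by omega) (by omega)]
      ring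
    · rw [if_neg (by omega), if_neg (by omega), if_neg (by omega), if_pos (by omega)]
      rw [show r + 1 = 0 + 2 * m * 1 by omega, lab_per, lab_lo m _ (by omega) (by omega)]
      ring

lemma rho_n (n : ℕ) : rhoFun n n = n := by
  unfold rhoFun; split_ifs <;> omega

lemma rho_neg_n (n : ℕ) (hn : 4 ≤ n) : rhoFun n (-n) = -n := by
  unfold rhoFun; split_ifs <;> omega

lemma sigma_lab (n : ℕ) (hn : 4 ≤ n) (k : ℤ) :
    sigmaFun n (lab ((n:ℤ) - 1) k) = lab ((n:ℤ) - 1) k := by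
  have hn' : (4:ℤ) ≤ n := by exact_mod_cast hn
  have h := (lab_abs ((n:ℤ) - 1) k (by omega)).2
  rw [abs_le] at h
  unfold sigmaFun
  rw [if_neg (by omega), if_neg (by omega)]

lemma rho_iter (n : ℕ) (hn : 4 ≤ n) (s : ℕ) (k : ℤ) :
    (rhoFun n)^[s] (lab ((n:ℤ) - 1) k) = lab ((n:ℤ) - 1) (k + s) := by
  induction s with
  | zero => simp
  | succ i ih =>
    rw [Function.iterate_succ_apply', ih, rho_lab n hn]
    congr 1
    push_cast; ring

lemma g_lab (n : ℕ) (hn : 4 ≤ n) (s : ℕ) (k : ℤ) :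
    ((sigmaFun n)^[s + 1] ∘ (rhoFun n)^[s]) (lab ((n:ℤ) - 1) k) = lab ((n:ℤ) - 1) (k + s) := by
  rw [Function.comp_apply, rho_iter n hn, Function.iterate_fixed (sigma_lab n hn _)]

lemma sigma_n (n : ℕ) : sigmaFun n n = -n := by
  unfold sigmaFun; split_ifs <;> omega

lemma sigma_neg_n (n : ℕ) (hn : 4 ≤ n) : sigmaFun n (-n) = n := by
  unfold sigmaFun; split_ifs <;> omega

lemma g_n (n : ℕ) (hn : 4 ≤ n) (s : ℕ) :
    (Odd s ∧ ((sigmaFun n)^[s + 1] ∘ (rhoFun n)^[s]) n = n ∧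
      ((sigmaFun n)^[s + 1] ∘ (rhoFun n)^[s]) (-n) = -n) ∨
    (Even s ∧ ((sigmaFun n)^[s + 1] ∘ (rhoFun n)^[s]) n = -n ∧
      ((sigmaFun n)^[s + 1] ∘ (rhoFun n)^[s]) (-n) = n) := by
  simp only [Function.comp_apply]
  rw [Function.iterate_fixed (rho_n n), Function.iterate_fixed (rho_neg_n n hn)]
  have e1 : (sigmaFun n)^[2] n = n := by simp [sigma_n, sigma_neg_n n hn]
  have e2 : (sigmaFun n)^[2] (-n) = -n := by simp [sigma_n, sigma_neg_n n hn]
  rcases Nat.even_or_odd' s with ⟨c, rfl | rfl⟩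
  · right
    refine ⟨⟨c, by ring⟩, ?_, ?_⟩
    · rw [Function.iterate_succ_apply', Function.iterate_mul, Function.iterate_fixed e1, sigma_n]
    · rw [Function.iterate_succ_apply', Function.iterate_mul, Function.iterate_fixed e2,
        sigma_neg_n n hn]
  · left
    refine ⟨⟨c, by ring⟩, ?_, ?_⟩
    · rw [show 2 * c + 1 + 1 = 2 * (c + 1) by ring, Function.iterate_mul,
        Function.iterate_fixed e1]
    · rw [show 2 * c + 1 + 1 = 2 * (c + 1) by ring, Function.iterate_mul,
        Function.iterate_fixed e2]

lemma Qpt_per (m k j : ℤ) (hm : 0 < m) : Qpt m (k + 2 * m * j) = Qpt m k := by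
  have hm' : (m:ℝ) ≠ 0 := by exact_mod_cast hm.ne'
  have e : Real.pi * ((k + 2 * m * j : ℤ) : ℝ) / m = Real.pi * k / m + j * (2 * Real.pi) := by
    push_cast; field_simp
  simp only [Qpt, e, Real.cos_add_int_mul_two_pi, Real.sin_add_int_mul_two_pi]

lemma pt_lab (n : ℕ) (hn : 4 ≤ n) (k : ℤ) :
    pt n (lab ((n:ℤ) - 1) k) = Qpt ((n:ℤ) - 1) k := by
  have hn' : (4:ℤ) ≤ n := by exact_mod_cast hn
  obtain ⟨m, hm⟩ : ∃ m : ℤ, m = (n:ℤ) - 1 := ⟨_, rfl⟩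
  have hmr : (m:ℝ) = (n:ℝ) - 1 := by rw [hm]; push_cast; ring
  have hm0 : (m:ℝ) ≠ 0 := by
    have : m ≠ 0 := by omega
    exact_mod_cast this
  rw [← hm]
  have h := (lab_abs m k (by omega)).2
  unfold pt
  rw [if_neg (by omega)]
  have ed : (2 * (n:ℝ) - 2) = 2 * m := by rw [hmr]; ring
  obtain ⟨r, j, hk, hr⟩ := lab_cases m k (by omega)
  have er : posR n (lab m k) = r := by
    unfold posR
    rcases hr with ⟨h1, h2, h3⟩ | ⟨h1, h2, h3⟩
    · rw [if_pos (by omega), h3]; push_cast; ring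
    · rw [if_neg (by omega), h3, ← hmr]; push_cast; ring
  rw [er, ed, hk, Qpt_per m r j (by omega), Real.cos_neg, Real.sin_neg]
  have e : 2 * Real.pi * (r:ℝ) / (2 * m) = Real.pi * r / m := by field_simp
  rw [e]; rfl

lemma pt_n (n : ℕ) : pt n n = (0, 0) := by simp [pt]

lemma pt_neg_n (n : ℕ) : pt n (-n) = (0, 0) := by simp [pt]

lemma mem_signed (n : ℕ) (hn : 4 ≤ n) (i : ℤ) :
    i ∈ signedSet n ↔ i = n ∨ i = -n ∨ ∃ k, i = lab ((n:ℤ) - 1) k := by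
  have hn' : (4:ℤ) ≤ n := by exact_mod_cast hn
  constructor
  · rintro ⟨h1, h2⟩
    by_cases h : |i| ≤ (n:ℤ) - 1
    · exact Or.inr (Or.inr (lab_surj _ i h1 h))
    · rcases abs_cases i with h' | h' <;> omega
  · rintro (rfl | rfl | ⟨k, rfl⟩)
    · simp [signedSet]; omega
    · simp [signedSet]; omega
    · have := lab_abs ((n:ℤ) - 1) k (by omega)
      exact ⟨this.1, by omega⟩

lemma lab_ne (n : ℕ) (hn : 4 ≤ n) (k : ℤ) :
    lab ((n:ℤ) - 1) k ≠ n ∧ lab ((n:ℤ) - 1) k ≠ -n := by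
  have hn' : (4:ℤ) ≤ n := by exact_mod_cast hn
  have h := (lab_abs ((n:ℤ) - 1) k (by omega)).2
  rw [abs_le] at h
  omega

/-- the standing numerical data -/
structure Ctx (n s : ℕ) (p m : ℤ) (g : ℤ → ℤ) : Prop where
  hn : 4 ≤ n
  hm : m = (n:ℤ) - 1
  modd : Odd m
  hp : 0 < p
  hpm : p ∣ m
  h3 : 3 * p ≤ m
  bez : ∃ u v, p = m * u + s * v
  hps : p ∣ s
  g1 : ∀ k, g (lab m k) = lab m (k + s)
  g2 : (Odd s ∧ g n = n ∧ g (-n) = -n) ∨ (Even s ∧ g n = -n ∧ g (-n) = n)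

/-- the relation on positions induced by a partition -/
def relOf (m : ℤ) (w : Set (Set ℤ)) (x y : ℤ) : Prop := ∃ B ∈ w, lab m x ∈ B ∧ lab m y ∈ B

/-- the block of `x` -/
def cls (n : ℕ) (p m : ℤ) (R : ℤ → ℤ → Prop) (x : ℤ) : Set ℤ :=
  {i | (∃ y, R x y ∧ i = lab m y) ∨ (R x (x + p) ∧ (i = n ∨ i = -n))}

/-- the partition of a relation -/
def WW (n : ℕ) (p m : ℤ) (R : ℤ → ℤ → Prop) : Set (Set ℤ) :=
  {B | (∃ x, B = cls n p m R x) ∨ ((∀ x, ¬ R x (x + p)) ∧ (B = {(n:ℤ)} ∨ B = {-(n:ℤ)}))}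

section forward

variable {n s : ℕ} {p m : ℤ} {g : ℤ → ℤ}

lemma Ctx.m0 (c : Ctx n s p m g) : 0 < m := by have := c.hp; have := c.h3; omega

lemma Ctx.signed (c : Ctx n s p m g) (i : ℤ) :
    i ∈ signedSet n ↔ i = n ∨ i = -n ∨ ∃ k, i = lab m k := by
  rw [c.hm]; exact mem_signed n c.hn i

lemma Ctx.ne (c : Ctx n s p m g) (k : ℤ) : lab m k ≠ n ∧ lab m k ≠ -n := by
  rw [c.hm]; exact lab_ne n c.hn k

lemma Ctx.ptl (c : Ctx n s p m g) (k : ℤ) : pt n (lab m k) = Qpt m k := by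
  rw [c.hm]; exact pt_lab n c.hn k

lemma Ctx.labS (c : Ctx n s p m g) (k : ℤ) : lab m k ∈ signedSet n :=
  (c.signed _).2 (Or.inr (Or.inr ⟨k, rfl⟩))

lemma uniq {S : Set ℤ} {w : Set (Set ℤ)} (h : IsPartitionOf S w) {B B' : Set ℤ} (hB : B ∈ w)
    (hB' : B' ∈ w) {i : ℤ} (hi : i ∈ B) (hi' : i ∈ B') : B = B' :=
  (h.2.2 i (h.2.1 B hB hi)).unique ⟨hB, hi⟩ ⟨hB', hi'⟩

lemma Ctx.img {w : Set (Set ℤ)} (hg : InvUnder g w) {B : Set ℤ} (hB : B ∈ w) : g '' B ∈ w := by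
  rw [← hg]; exact ⟨B, hB, rfl⟩

lemma Ctx.shift_s (c : Ctx n s p m g) {w : Set (Set ℤ)} (hw : w ∈ NCD n) (hg : InvUnder g w)
    (x y : ℤ) : relOf m w x y ↔ relOf m w (x + s) (y + s) := by
  constructor
  · rintro ⟨B, hB, h1, h2⟩
    exact ⟨g '' B, Ctx.img hg hB, ⟨_, h1, c.g1 x⟩, ⟨_, h2, c.g1 y⟩⟩
  · rintro ⟨B, hB, h1, h2⟩
    rw [← hg] at hB
    obtain ⟨B', hB', rfl⟩ := hB
    have key : ∀ x, lab m (x + s) ∈ g '' B' → lab m x ∈ B' := by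
      rintro x ⟨i, hi, hix⟩
      rcases (c.signed i).1 (hw.1.1.2.1 B' hB' hi) with rfl | rfl | ⟨k, rfl⟩
      · exfalso
        have := c.ne (x + s)
        rcases c.g2 with ⟨_, e1, e2⟩ | ⟨_, e1, e2⟩
        · exact this.1 (hix.symm.trans e1)
        · exact this.2 (hix.symm.trans e1)
      · exfalso
        have := c.ne (x + s)
        rcases c.g2 with ⟨_, e1, e2⟩ | ⟨_, e1, e2⟩
        · exact this.2 (hix.symm.trans e2)
        · exact this.1 (hix.symm.trans e2)
      · rw [c.g1, lab_eq_iff m _ _ c.m0] at hix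
        obtain ⟨j, hj⟩ := hix
        have : lab m x = lab m k := by
          rw [show x = k + 2 * m * j by linarith, lab_per]
        rwa [this]
    exact ⟨B', hB', key x h1, key y h2⟩

lemma neg_mem_block {w : Set (Set ℤ)} (hw : w ∈ NCD n) {B : Set ℤ} (hB : B ∈ w) :
    ∃ B' ∈ w, ∀ i, i ∈ B' ↔ -i ∈ B := by
  refine ⟨_, hw.1.2.1 B hB, ?_⟩
  intro i
  constructor
  · rintro ⟨j, hj, rfl⟩
    simpa using hj
  · intro h
    exact ⟨-i, h, by simp⟩

lemma Ctx.shift_m (c : Ctx n s p m g) {w : Set (Set ℤ)} (hw : w ∈ NCD n)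
    (x y : ℤ) : relOf m w x y ↔ relOf m w (x + m) (y + m) := by
  simp only [relOf, lab_add_m m _ c.m0]
  constructor
  · rintro ⟨B, hB, h1, h2⟩
    obtain ⟨B', hB', h⟩ := neg_mem_block hw hB
    exact ⟨B', hB', (h _).2 (by simpa using h1), (h _).2 (by simpa using h2)⟩
  · rintro ⟨B, hB, h1, h2⟩
    obtain ⟨B', hB', h⟩ := neg_mem_block hw hB
    exact ⟨B', hB', (h _).2 h1, (h _).2 h2⟩

lemma Ctx.rel_isM1 (c : Ctx n s p m g) {w : Set (Set ℤ)} (hw : w ∈ NCD n) (hg : InvUnder g w) :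
    IsM1 p m (relOf m w) where
  refl x := by
    obtain ⟨B, ⟨hB, hx⟩, _⟩ := hw.1.1.2.2 _ (c.labS x)
    exact ⟨B, hB, hx, hx⟩
  symm := by
    rintro x y ⟨B, hB, h1, h2⟩
    exact ⟨B, hB, h2, h1⟩
  trans := by
    rintro x y z ⟨B, hB, h1, h2⟩ ⟨B', hB', h3, h4⟩
    have := uniq hw.1.1 hB hB' h2 h3
    subst this
    exact ⟨B, hB, h1, h4⟩
  per x y := by
    obtain ⟨u, v, huv⟩ := c.bez
    rw [shift_mul (c.shift_m hw) u, shift_mul (c.shift_s hw hg) v, huv]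
    ring_nf
  wrap x := by
    obtain ⟨B, ⟨hB, hx⟩, _⟩ := hw.1.1.2.2 _ (c.labS x)
    refine ⟨B, hB, hx, ?_⟩
    rw [show x + 2 * m = x + 2 * m * 1 by ring, lab_per]; exact hx
  nc := by
    rintro x y z t hxy hyz hzt htx ⟨B, hB, hx, hz⟩ ⟨B', hB', hy, ht⟩
    by_contra hcon
    have hne : B ≠ B' := by
      rintro rfl
      exact hcon ⟨B, hB, hx, hy⟩
    have m0 := c.m0
    have mp : ∀ k, ∀ B : Set ℤ, lab m k ∈ B → Qpt m k ∈ pt n '' B :=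
      fun k B hk => ⟨_, hk, c.ptl k⟩
    apply hw.2 B hB B' hB' hne
    refine ⟨?_, Or.inl ?_⟩
    · intro he
      have hin : Qpt m y ∈ hullOf n B := by
        rw [he]
        exact subset_convexHull ℝ _ (mp y B' hy)
      refine Qpt_not_mem_hull m y m0 _ ?_ hin
      rintro v ⟨i, hi, rfl⟩
      rcases (c.signed i).1 (hw.1.1.2.1 B hB hi) with rfl | rfl | ⟨k, rfl⟩
      · exact Or.inl (pt_n n)
      · exact Or.inl (pt_neg_n n)
      · refine Or.inr ⟨k, c.ptl k, ?_⟩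
        rintro ⟨j, hj⟩
        apply hcon
        refine ⟨B, hB, hx, ?_⟩
        rw [show k = y + 2 * m * j by linarith, lab_per] at hi
        exact hi
    · exact cross_of_order (Det_pos m x y z m0 hxy hyz (by omega))
        (Det_pos m x z t m0 (by omega) hzt htx) (Det_pos m x y t m0 hxy (by omega) htx)
        (Det_pos m y z t m0 hyz hzt (by omega)) (mp x B hx) (mp z B hz) (mp y B' hy) (mp t B' ht)

lemma iter_mem {m : ℤ} (hm : 0 < m) {N : Set ℤ} {d : ℤ}
    (h : ∀ k, lab m k ∈ N → lab m (k + d) ∈ N) (k : ℤ) (hk : lab m k ∈ N) (j : ℤ) :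
    lab m (k + d * j) ∈ N := by
  have key : ∀ j : ℕ, lab m (k + d * j) ∈ N := by
    intro j
    induction j with
    | zero => simpa using hk
    | succ i ih =>
      have := h _ ih
      rw [show k + d * ((i + 1 : ℕ) : ℤ) = k + d * i + d by push_cast; ring]
      exact this
  have h0 : 0 ≤ j % (2 * m) := Int.emod_nonneg _ (by omega)
  have := key (j % (2 * m)).toNat
  rw [Int.toNat_of_nonneg h0] at this
  have e : k + d * j = k + d * (j % (2 * m)) + 2 * m * (d * (j / (2 * m))) := by
    have := Int.emod_add_mul_ediv j (2 * m)
    linear_combination -d * this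
  rw [e, lab_per]; exact this

lemma Ctx.lemA (c : Ctx n s p m g) {w : Set (Set ℤ)} (hw : w ∈ NCD n) (hg : InvUnder g w)
    {N : Set ℤ} (hN : N ∈ w) (hn : (n:ℤ) ∈ N) {k : ℤ} (hk : lab m k ∈ N) : -(n:ℤ) ∈ N := by
  have m0 := c.m0
  have hd : ∃ d : ℤ, Odd d ∧ ∀ k, lab m k ∈ N → lab m (k + d) ∈ N := by
    rcases c.g2 with ⟨hs, e1, e2⟩ | ⟨hs, e1, e2⟩
    · refine ⟨s, by exact_mod_cast hs, ?_⟩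
      intro k hk
      have : g '' N = N := uniq hw.1.1 (Ctx.img hg hN) hN ⟨_, hn, e1⟩ hn
      rw [← this]
      exact ⟨_, hk, c.g1 k⟩
    · refine ⟨s + m, Even.add_odd (by exact_mod_cast hs) c.modd, ?_⟩
      intro k hk
      obtain ⟨B', hB', hb⟩ := neg_mem_block hw (Ctx.img hg hN)
      have : B' = N := uniq hw.1.1 hB' hN ((hb _).2 ⟨_, hn, e1⟩) hn
      subst this
      rw [← add_assoc, lab_add_m m _ m0, hb]
      exact ⟨_, hk, by rw [c.g1]; simp⟩
  obtain ⟨d, ⟨e, he⟩, hd⟩ := hd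
  have h1 := iter_mem m0 hd k hk m
  rw [show k + d * m = k + m + 2 * m * e by rw [he]; ring, lab_per, lab_add_m m _ m0] at h1
  obtain ⟨B', hB', hb⟩ := neg_mem_block hw hN
  have : B' = N := uniq hw.1.1 hB' hN ((hb _).2 h1) hk
  subst this
  rw [hb]; simpa using hn

lemma Ctx.lemA2 (c : Ctx n s p m g) {w : Set (Set ℤ)} (hw : w ∈ NCD n) (hg : InvUnder g w)
    {N : Set ℤ} (hN : N ∈ w) (hn : -(n:ℤ) ∈ N) {k : ℤ} (hk : lab m k ∈ N) : (n:ℤ) ∈ N := by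
  obtain ⟨B', hB', hb⟩ := neg_mem_block hw hN
  have h1 := c.lemA hw hg hB' ((hb _).2 hn) (k := k + m)
    ((hb _).2 (by rw [lab_add_m m _ c.m0]; simpa using hk))
  rw [hb] at h1
  simpa using h1

lemma Ctx.lemB (c : Ctx n s p m g) {w : Set (Set ℤ)} (hw : w ∈ NCD n) (hg : InvUnder g w)
    {N : Set ℤ} (hN : N ∈ w) (hn : (n:ℤ) ∈ N) {k : ℤ} (hk : lab m k ∈ N) :
    relOf m w k (k + p) := by
  have m0 := c.m0
  have hn2 := c.lemA hw hg hN hn hk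
  have hgN : g '' N = N := by
    rcases c.g2 with ⟨hs, e1, e2⟩ | ⟨hs, e1, e2⟩
    · exact uniq hw.1.1 (Ctx.img hg hN) hN ⟨_, hn, e1⟩ hn
    · exact uniq hw.1.1 (Ctx.img hg hN) hN ⟨_, hn2, e2⟩ hn
  have h1 : ∀ k, lab m k ∈ N → lab m (k + s) ∈ N := by
    intro k hk
    rw [← hgN]
    exact ⟨_, hk, c.g1 k⟩
  obtain ⟨B', hB', hb⟩ := neg_mem_block hw hN
  have : B' = N := uniq hw.1.1 hB' hN ((hb _).2 hn2) hn
  subst this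
  have h2 : ∀ k, lab m k ∈ B' → lab m (k + m) ∈ B' := by
    intro k hk
    rw [lab_add_m m _ m0, hb]
    simpa using hk
  obtain ⟨u, v, huv⟩ := c.bez
  refine ⟨B', hB', hk, ?_⟩
  rw [huv, ← add_assoc]
  exact iter_mem m0 h1 _ (iter_mem m0 h2 _ hk u) v

lemma Ctx.zero_of_central (c : Ctx n s p m g) {R : ℤ → ℤ → Prop} (hR : IsM1 p m R) {x : ℤ}
    (hx : R x (x + p)) : R x (x + m) := by
  obtain ⟨q, hq⟩ := c.hpm
  rw [hq]; exact hR.step hx q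

lemma rel_mem {w : Set (Set ℤ)} (hw : w ∈ NCD n) {B : Set ℤ} (hB : B ∈ w) {x y : ℤ}
    (hx : lab m x ∈ B) (h : relOf m w x y) : lab m y ∈ B := by
  obtain ⟨B', hB', h1, h2⟩ := h
  rwa [uniq hw.1.1 hB hB' hx h1]

lemma Ctx.lemC (c : Ctx n s p m g) {w : Set (Set ℤ)} (hw : w ∈ NCD n) (hg : InvUnder g w)
    {B : Set ℤ} (hB : B ∈ w) {x : ℤ} (hx : lab m x ∈ B) (hc : relOf m w x (x + p)) :
    (n:ℤ) ∈ B ∧ -(n:ℤ) ∈ B := by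
  have m0 := c.m0
  have hxm := rel_mem hw hB hx (c.zero_of_central (c.rel_isM1 hw hg) hc)
  have hxm' := hxm
  rw [lab_add_m m _ m0] at hxm
  obtain ⟨N, ⟨hN, hnN⟩, _⟩ := hw.1.1.2.2 n ((c.signed _).2 (Or.inl rfl))
  by_cases h : -(n:ℤ) ∈ N
  · have : B = N := hw.1.2.2.1 B hB N hN ⟨_, hx, hxm⟩ ⟨_, hnN, h⟩
    subst this
    exact ⟨hnN, h⟩
  · exfalso
    have hsing : N = {(n:ℤ)} := by
      apply Set.Subset.antisymm
      · intro i hi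
        rcases (c.signed i).1 (hw.1.1.2.1 N hN hi) with rfl | rfl | ⟨k, rfl⟩
        · rfl
        · exact absurd hi h
        · exact absurd (c.lemA hw hg hN hnN hi) h
      · rintro i rfl
        exact hnN
    have hhull : hullOf n N = {((0:ℝ), (0:ℝ))} := by
      rw [hsing, hullOf, Set.image_singleton, pt_n, convexHull_singleton]
    have hne : N ≠ B := by
      rintro rfl
      rw [hsing] at hx
      exact (c.ne x).1 hx
    have hQ : Qpt m x ∈ hullOf n B := subset_convexHull ℝ _ ⟨_, hx, c.ptl x⟩
    have hQ' : Qpt m (x + m) ∈ hullOf n B := subset_convexHull ℝ _ ⟨_, hxm', c.ptl _⟩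
    apply hw.2 N hN B hB hne
    refine ⟨?_, Or.inl ⟨(0, 0), ?_, ?_⟩⟩
    · intro he
      rw [← he] at hQ
      refine Qpt_not_mem_hull m x m0 _ ?_ hQ
      rintro v ⟨i, hi, rfl⟩
      rw [hsing] at hi
      left
      rw [show i = n from hi, pt_n]
    · have hm' : (m:ℝ) ≠ 0 := by exact_mod_cast m0.ne'
      have e : Real.pi * ((x + m : ℤ) : ℝ) / m = Real.pi * x / m + Real.pi := by
        push_cast; field_simp
      have : ((0:ℝ), (0:ℝ)) = (1 / 2 : ℝ) • Qpt m x + (1 / 2 : ℝ) • Qpt m (x + m) := by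
        simp only [Qpt, e, Real.cos_add_pi, Real.sin_add_pi]
        ext <;> simp
      rw [this]
      exact convex_convexHull ℝ _ hQ hQ' (by norm_num) (by norm_num) (by norm_num)
    · rw [hhull]; simp

lemma Ctx.block_eq (c : Ctx n s p m g) {w : Set (Set ℤ)} (hw : w ∈ NCD n) (hg : InvUnder g w)
    {B : Set ℤ} (hB : B ∈ w) {x : ℤ} (hx : lab m x ∈ B) : B = cls n p m (relOf m w) x := by
  ext i
  constructor
  · intro hi
    rcases (c.signed i).1 (hw.1.1.2.1 B hB hi) with rfl | rfl | ⟨k, rfl⟩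
    · exact Or.inr ⟨c.lemB hw hg hB hi hx, Or.inl rfl⟩
    · exact Or.inr ⟨c.lemB hw hg hB (c.lemA2 hw hg hB hi hx) hx, Or.inr rfl⟩
    · exact Or.inl ⟨k, ⟨B, hB, hx, hi⟩, rfl⟩
  · rintro (⟨y, hy, rfl⟩ | ⟨hc, rfl | rfl⟩)
    · exact rel_mem hw hB hx hy
    · exact (c.lemC hw hg hB hx hc).1
    · exact (c.lemC hw hg hB hx hc).2

lemma Ctx.no_lab (c : Ctx n s p m g) {w : Set (Set ℤ)} (hw : w ∈ NCD n)
    {B : Set ℤ} (hB : B ∈ w) (h : ∀ x, lab m x ∉ B) : 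
    ((n:ℤ) ∈ B ∧ B = {(n:ℤ)}) ∨ (-(n:ℤ) ∈ B ∧ B = {-(n:ℤ)}) := by
  have hsub : ∀ i ∈ B, i = n ∨ i = -n := by
    intro i hi
    rcases (c.signed i).1 (hw.1.1.2.1 B hB hi) with rfl | rfl | ⟨k, rfl⟩
    · simp
    · simp
    · exact absurd hi (h k)
  obtain ⟨i, hi⟩ := hw.1.1.1 B hB
  have hne := hw.1.2.2.2 B hB n
  by_cases h1 : (n:ℤ) ∈ B
  · by_cases h2 : -(n:ℤ) ∈ B
    · exfalso
      apply hne
      ext i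
      constructor
      · intro hi; rcases hsub i hi with rfl | rfl <;> simp
      · rintro (rfl | rfl)
        · exact h1
        · exact h2
    · refine Or.inl ⟨h1, Set.Subset.antisymm ?_ (by rintro i rfl; exact h1)⟩
      intro i hi
      rcases hsub i hi with rfl | rfl
      · rfl
      · exact absurd hi h2
  · have h2 : -(n:ℤ) ∈ B := by
      rcases hsub i hi with rfl | rfl
      · exact absurd hi h1
      · exact hi
    refine Or.inr ⟨h2, Set.Subset.antisymm ?_ (by rintro i rfl; exact h2)⟩
    intro i hi
    rcases hsub i hi with rfl | rfl
    · exact absurd hi h1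
    · rfl

lemma Ctx.w_eq (c : Ctx n s p m g) {w : Set (Set ℤ)} (hw : w ∈ NCD n) (hg : InvUnder g w) :
    w = WW n p m (relOf m w) := by
  ext B
  constructor
  · intro hB
    by_cases h : ∃ x, lab m x ∈ B
    · obtain ⟨x, hx⟩ := h
      exact Or.inl ⟨x, c.block_eq hw hg hB hx⟩
    · push Not at h
      right
      have h2 := c.no_lab hw hB h
      constructor
      · intro x hx
        obtain ⟨B', ⟨hB', hx'⟩, _⟩ := hw.1.1.2.2 _ (c.labS x)
        have h3 := c.lemC hw hg hB' hx' hx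
        rcases h2 with ⟨h4, _⟩ | ⟨h4, _⟩
        · rw [uniq hw.1.1 hB hB' h4 h3.1] at h
          exact h x hx'
        · rw [uniq hw.1.1 hB hB' h4 h3.2] at h
          exact h x hx'
      · rcases h2 with ⟨_, h4⟩ | ⟨_, h4⟩
        · exact Or.inl h4
        · exact Or.inr h4
  · rintro (⟨x, rfl⟩ | ⟨hno, hB⟩)
    · obtain ⟨B', ⟨hB', hx'⟩, _⟩ := hw.1.1.2.2 _ (c.labS x)
      rw [← c.block_eq hw hg hB' hx']; exact hB'
    · have hn0 : (n:ℤ) ≠ 0 := by have := c.hn; omega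
      rcases hB with rfl | rfl
      · obtain ⟨N, ⟨hN, hnN⟩, _⟩ := hw.1.1.2.2 n ((c.signed _).2 (Or.inl rfl))
        rcases c.no_lab hw hN (fun x hx => hno x (c.lemB hw hg hN hnN hx)) with ⟨_, h⟩ | ⟨_, h⟩
        · rwa [← h]
        · exfalso
          rw [h] at hnN
          have : (n:ℤ) = -n := hnN
          omega
      · obtain ⟨N, ⟨hN, hnN⟩, _⟩ := hw.1.1.2.2 (-n) ((c.signed _).2 (Or.inr (Or.inl rfl)))
        rcases c.no_lab hw hN
          (fun x hx => hno x (c.lemB hw hg hN (c.lemA2 hw hg hN hnN hx) hx)) with ⟨_, h⟩ | ⟨_, h⟩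
        · exfalso
          rw [h] at hnN
          have : -(n:ℤ) = n := hnN
          omega
        · rwa [← h]

end forward

section backward

variable {n s : ℕ} {p m : ℤ} {g : ℤ → ℤ}

lemma Ctx.lab_mem_cls (c : Ctx n s p m g) {R : ℤ → ℤ → Prop} (hR : IsM1 p m R) (x y : ℤ) :
    lab m y ∈ cls n p m R x ↔ R x y := by
  constructor
  · rintro (⟨z, hz, he⟩ | ⟨_, h | h⟩)
    · obtain ⟨j, rfl⟩ := (lab_eq_iff m _ _ c.m0).1 he
      exact hR.trans hz (hR.symm (hR.wrap_mul y j))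
    · exact absurd h (c.ne y).1
    · exact absurd h (c.ne y).2
  · intro h
    exact Or.inl ⟨y, h, rfl⟩

lemma Ctx.n_mem_cls (c : Ctx n s p m g) {R : ℤ → ℤ → Prop} (x : ℤ) :
    (n:ℤ) ∈ cls n p m R x ↔ R x (x + p) := by
  constructor
  · rintro (⟨z, hz, he⟩ | ⟨h, _⟩)
    · exact absurd he.symm (c.ne z).1
    · exact h
  · intro h
    exact Or.inr ⟨h, Or.inl rfl⟩

lemma Ctx.neg_n_mem_cls (c : Ctx n s p m g) {R : ℤ → ℤ → Prop} (x : ℤ) :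
    -(n:ℤ) ∈ cls n p m R x ↔ R x (x + p) := by
  constructor
  · rintro (⟨z, hz, he⟩ | ⟨h, _⟩)
    · exact absurd he.symm (c.ne z).2
    · exact h
  · intro h
    exact Or.inr ⟨h, Or.inr rfl⟩

lemma cls_eq {R : ℤ → ℤ → Prop} (hR : IsM1 p m R) {x y : ℤ} (h : R x y) :
    cls n p m R x = cls n p m R y := by
  have hc : R x (x + p) ↔ R y (y + p) := ⟨hR.central h, hR.central (hR.symm h)⟩
  ext i
  simp only [cls, Set.mem_ofPred_eq, hc]
  constructor
  · rintro (⟨z, hz, rfl⟩ | h')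
    · exact Or.inl ⟨z, hR.trans (hR.symm h) hz, rfl⟩
    · exact Or.inr h'
  · rintro (⟨z, hz, rfl⟩ | h')
    · exact Or.inl ⟨z, hR.trans h hz, rfl⟩
    · exact Or.inr h'

lemma shift_dvd {R : ℤ → ℤ → Prop} (hR : IsM1 p m R) {d : ℤ} (hd : p ∣ d) (x y : ℤ) :
    R x y ↔ R (x + d) (y + d) := by
  obtain ⟨q, rfl⟩ := hd
  exact shift_mul hR.per q x y

lemma Ctx.img_cls {R : ℤ → ℤ → Prop} (hR : IsM1 p m R) {h : ℤ → ℤ} {d : ℤ}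
    (hd : p ∣ d) (h1 : ∀ k, h (lab m k) = lab m (k + d))
    (h2 : (h n = n ∧ h (-n) = -n) ∨ (h n = -n ∧ h (-n) = n)) (x : ℤ) :
    h '' cls n p m R x = cls n p m R (x + d) := by
  have hc : R x (x + p) ↔ R (x + d) (x + d + p) := by
    rw [shift_dvd hR hd x (x + p), add_right_comm]
  ext i
  constructor
  · rintro ⟨i, ⟨y, hy, rfl⟩ | ⟨hx, hi⟩, rfl⟩
    · exact Or.inl ⟨y + d, (shift_dvd hR hd _ _).1 hy, h1 y⟩
    · refine Or.inr ⟨hc.1 hx, ?_⟩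
      rcases hi with rfl | rfl
      · rcases h2 with h2 | h2
        · exact Or.inl h2.1
        · exact Or.inr h2.1
      · rcases h2 with h2 | h2
        · exact Or.inr h2.2
        · exact Or.inl h2.2
  · rintro (⟨y, hy, rfl⟩ | ⟨hx, hi⟩)
    · refine ⟨lab m (y - d), Or.inl ⟨y - d, ?_, rfl⟩, ?_⟩
      · rw [shift_dvd hR hd]; simpa using hy
      · rw [h1]; simp
    · have hx' := hc.2 hx
      rcases hi with rfl | rfl
      · rcases h2 with h2 | h2
        · exact ⟨n, Or.inr ⟨hx', Or.inl rfl⟩, h2.1⟩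
        · exact ⟨-n, Or.inr ⟨hx', Or.inr rfl⟩, h2.2⟩
      · rcases h2 with h2 | h2
        · exact ⟨-n, Or.inr ⟨hx', Or.inr rfl⟩, h2.2⟩
        · exact ⟨n, Or.inr ⟨hx', Or.inl rfl⟩, h2.1⟩

lemma Ctx.img_WW {R : ℤ → ℤ → Prop} (hR : IsM1 p m R) {h : ℤ → ℤ} {d : ℤ}
    (hd : p ∣ d) (h1 : ∀ k, h (lab m k) = lab m (k + d))
    (h2 : (h n = n ∧ h (-n) = -n) ∨ (h n = -n ∧ h (-n) = n)) :
    InvUnder h (WW n p m R) := by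
  have key := fun x => Ctx.img_cls (n := n) hR hd h1 h2 x
  ext B
  constructor
  · rintro ⟨B, ⟨x, rfl⟩ | ⟨hno, hB⟩, rfl⟩
    · exact Or.inl ⟨x + d, key x⟩
    · refine Or.inr ⟨hno, ?_⟩
      rcases hB with rfl | rfl <;> rcases h2 with h2 | h2 <;> simp [h2.1, h2.2]
  · rintro (⟨x, rfl⟩ | ⟨hno, hB⟩)
    · refine ⟨cls n p m R (x - d), Or.inl ⟨_, rfl⟩, ?_⟩
      have := key (x - d)
      simpa using this
    · rcases h2 with h2 | h2
      · refine ⟨B, Or.inr ⟨hno, hB⟩, ?_⟩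
        rcases hB with rfl | rfl <;> simp [h2.1, h2.2]
      · rcases hB with rfl | rfl
        · exact ⟨{-(n:ℤ)}, Or.inr ⟨hno, Or.inr rfl⟩, by simp [h2.2]⟩
        · exact ⟨{(n:ℤ)}, Or.inr ⟨hno, Or.inl rfl⟩, by simp [h2.1]⟩

lemma Ctx.WW_inv (c : Ctx n s p m g) {R : ℤ → ℤ → Prop} (hR : IsM1 p m R) :
    InvUnder g (WW n p m R) :=
  Ctx.img_WW hR c.hps c.g1 (c.g2.imp (fun h => h.2) (fun h => h.2))

lemma Ctx.WW_part (c : Ctx n s p m g) {R : ℤ → ℤ → Prop} (hR : IsM1 p m R) :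
    IsPartitionOf (signedSet n) (WW n p m R) := by
  have hn0 : (0:ℤ) < n := by have := c.hn; omega
  refine ⟨?_, ?_, ?_⟩
  · rintro B (⟨x, rfl⟩ | ⟨_, rfl | rfl⟩)
    · exact ⟨_, (c.lab_mem_cls hR x x).2 (hR.refl x)⟩
    · exact ⟨n, rfl⟩
    · exact ⟨-n, rfl⟩
  · rintro B (⟨x, rfl⟩ | ⟨_, rfl | rfl⟩)
    · rintro i (⟨y, _, rfl⟩ | ⟨_, rfl | rfl⟩)
      · exact c.labS y
      · exact (c.signed _).2 (Or.inl rfl)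
      · exact (c.signed _).2 (Or.inr (Or.inl rfl))
    · rintro i rfl
      exact (c.signed _).2 (Or.inl rfl)
    · rintro i rfl
      exact (c.signed _).2 (Or.inr (Or.inl rfl))
  · intro i hi
    rcases (c.signed i).1 hi with rfl | rfl | ⟨k, rfl⟩
    · by_cases hc : ∃ x, R x (x + p)
      · obtain ⟨x, hx⟩ := hc
        refine ⟨cls n p m R x, ⟨Or.inl ⟨x, rfl⟩, (c.n_mem_cls x).2 hx⟩, ?_⟩
        rintro B ⟨⟨y, rfl⟩ | ⟨hno, _⟩, hB⟩
        · exact cls_eq hR (hR.two_central c.hp c.h3 ((c.n_mem_cls y).1 hB) hx)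
        · exact absurd hx (hno x)
      · push Not at hc
        refine ⟨{(n:ℤ)}, ⟨Or.inr ⟨hc, Or.inl rfl⟩, rfl⟩, ?_⟩
        rintro B ⟨⟨y, rfl⟩ | ⟨_, rfl | rfl⟩, hB⟩
        · exact absurd ((c.n_mem_cls y).1 hB) (hc y)
        · rfl
        · have : (n:ℤ) = -n := hB
          omega
    · by_cases hc : ∃ x, R x (x + p)
      · obtain ⟨x, hx⟩ := hc
        refine ⟨cls n p m R x, ⟨Or.inl ⟨x, rfl⟩, (c.neg_n_mem_cls x).2 hx⟩, ?_⟩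
        rintro B ⟨⟨y, rfl⟩ | ⟨hno, _⟩, hB⟩
        · exact cls_eq hR (hR.two_central c.hp c.h3 ((c.neg_n_mem_cls y).1 hB) hx)
        · exact absurd hx (hno x)
      · push Not at hc
        refine ⟨{-(n:ℤ)}, ⟨Or.inr ⟨hc, Or.inr rfl⟩, rfl⟩, ?_⟩
        rintro B ⟨⟨y, rfl⟩ | ⟨_, rfl | rfl⟩, hB⟩
        · exact absurd ((c.neg_n_mem_cls y).1 hB) (hc y)
        · have : -(n:ℤ) = n := hB
          omega
        · rfl
    · refine ⟨cls n p m R k, ⟨Or.inl ⟨k, rfl⟩, (c.lab_mem_cls hR k k).2 (hR.refl k)⟩, ?_⟩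
      rintro B ⟨⟨y, rfl⟩ | ⟨_, rfl | rfl⟩, hB⟩
      · exact cls_eq hR ((c.lab_mem_cls hR y k).1 hB)
      · exact absurd hB (c.ne k).1
      · exact absurd hB (c.ne k).2

lemma Ctx.WW_zero (c : Ctx n s p m g) {R : ℤ → ℤ → Prop} (hR : IsM1 p m R) {B : Set ℤ}
    (hB : B ∈ WW n p m R) {i : ℤ} (h1 : i ∈ B) (h2 : -i ∈ B) :
    ∃ x, B = cls n p m R x ∧ R x (x + p) := by
  have hn0 : (0:ℤ) < n := by have := c.hn; omega
  have m0 := c.m0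
  rcases hB with ⟨x, rfl⟩ | ⟨_, rfl | rfl⟩
  · refine ⟨x, rfl, ?_⟩
    rcases h1 with ⟨y, hy, rfl⟩ | ⟨h, _⟩
    · rw [← lab_add_m m _ m0, c.lab_mem_cls hR] at h2
      have h := hR.trans (hR.symm hy) h2
      have e : |y - (y + m)| = m := by
        rw [show y - (y + m) = -m by ring, abs_neg, abs_of_pos m0]
      have := c.hp
      have := c.h3
      exact hR.central (hR.symm hy) (hR.far c.hp h (by omega) (by omega))
    · exact h
  · have e1 : i = n := h1
    have e2 : -i = n := h2
    omega
  · have e1 : i = -n := h1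
    have e2 : -i = -n := h2
    omega

lemma Ctx.WW_Dn (c : Ctx n s p m g) {R : ℤ → ℤ → Prop} (hR : IsM1 p m R) :
    IsDnPartition n (WW n p m R) := by
  refine ⟨c.WW_part hR, ?_, ?_, ?_⟩
  · intro B hB
    have := Ctx.img_WW (n := n) (h := fun i => -i) hR c.hpm
      (fun k => (lab_add_m m k c.m0).symm) (Or.inr ⟨rfl, by simp⟩)
    exact Ctx.img this hB
  · rintro B hB B' hB' ⟨i, h1, h2⟩ ⟨i', h1', h2'⟩
    obtain ⟨x, rfl, hx⟩ := c.WW_zero hR hB h1 h2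
    obtain ⟨y, rfl, hy⟩ := c.WW_zero hR hB' h1' h2'
    exact cls_eq hR (hR.two_central c.hp c.h3 hx hy)
  · intro B hB i he
    obtain ⟨x, hBx, hx⟩ := c.WW_zero hR hB (i := i) (by rw [he]; simp) (by rw [he]; simp)
    have h1 : (n:ℤ) ∈ B := by rw [hBx]; exact (c.n_mem_cls x).2 hx
    have h2 : lab m x ∈ B := by rw [hBx]; exact (c.lab_mem_cls hR x x).2 (hR.refl x)
    rw [he] at h1 h2
    have := c.ne x
    simp only [Set.mem_insert_iff, Set.mem_singleton_iff] at h1 h2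
    omega

lemma Ctx.rel_WW (c : Ctx n s p m g) {R : ℤ → ℤ → Prop} (hR : IsM1 p m R) :
    relOf m (WW n p m R) = R := by
  funext x y
  apply propext
  constructor
  · rintro ⟨B, ⟨z, rfl⟩ | ⟨_, rfl | rfl⟩, h1, h2⟩
    · exact hR.trans (hR.symm ((c.lab_mem_cls hR z x).1 h1)) ((c.lab_mem_cls hR z y).1 h2)
    · exact absurd h1 (c.ne x).1
    · exact absurd h1 (c.ne x).2
  · intro h
    exact ⟨_, Or.inl ⟨x, rfl⟩, (c.lab_mem_cls hR x x).2 (hR.refl x), (c.lab_mem_cls hR x y).2 h⟩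

lemma Ctx.arc (c : Ctx n s p m g) {R : ℤ → ℤ → Prop} (hR : IsM1 p m R) {x : ℤ}
    (hx : ¬ R x (x + p)) : ∃ a b, a ≤ b ∧ b - a < p ∧ R x a ∧ R x b ∧
      ∀ y, R x y → ∃ j, a ≤ y + 2 * m * j ∧ y + 2 * m * j ≤ b := by
  have hp := c.hp
  have h3 := c.h3
  obtain ⟨a, ⟨ha1, ha2⟩, ha⟩ := Int.exists_least_of_bdd (P := fun y => R x y ∧ |x - y| < p)
    ⟨x - p, fun z hz => by have := (abs_lt.1 hz.2); omega⟩ ⟨x, hR.refl x, by simpa using hp⟩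
  obtain ⟨b, ⟨hb1, hb2⟩, hb⟩ := Int.exists_greatest_of_bdd (P := fun y => R x y ∧ |x - y| < p)
    ⟨x + p, fun z hz => by have := (abs_lt.1 hz.2); omega⟩ ⟨x, hR.refl x, by simpa using hp⟩
  have hax := ha x ⟨hR.refl x, by simpa using hp⟩
  have hbx := hb x ⟨hR.refl x, by simpa using hp⟩
  rw [abs_lt] at ha2 hb2
  refine ⟨a, b, by omega, ?_, ha1, hb1, ?_⟩
  · by_contra hcon
    have hab := hR.trans (hR.symm ha1) hb1
    have e : |a - b| = b - a := by rw [abs_of_nonpos (by omega)]; ring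
    exact hx (hR.central (hR.symm ha1) (hR.far hp hab (by omega) (by omega)))
  · intro y hy
    obtain ⟨j, hj1, hj2⟩ := exists_rep (2 * m) y (x + m) (by omega)
    refine ⟨j, ?_⟩
    have hy' : R x (y + 2 * m * j) := hR.trans hy (hR.wrap_mul y j)
    have hlt : |x - (y + 2 * m * j)| < p := by
      by_contra hcon
      refine hx (hR.far hp hy' (by omega) ?_)
      have : |x - (y + 2 * m * j)| ≤ m := by
        rw [abs_le]; constructor <;> linarith
      omega
    exact ⟨ha _ ⟨hy', hlt⟩, hb _ ⟨hy', hlt⟩⟩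

lemma Ctx.disj_arc (c : Ctx n s p m g) {R : ℤ → ℤ → Prop} {x a b : ℤ}
    (hx : ¬ R x (x + p)) (hab : a ≤ b) (hb : b - a < p)
    (hA : ∀ y, R x y → ∃ j, a ≤ y + 2 * m * j ∧ y + 2 * m * j ≤ b) {B : Set ℤ}
    (hB : B ⊆ signedSet n) (hno : ∀ k, lab m k ∈ B → a ≤ k → k ≤ b → False) :
    Disjoint (hullOf n (cls n p m R x)) (hullOf n B) := by
  have hp := c.hp
  have h3 := c.h3
  apply hull_disj m a b c.m0 hab (by omega)
  · rintro v ⟨i, ⟨y, hy, rfl⟩ | ⟨h, _⟩, rfl⟩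
    · obtain ⟨j, hj⟩ := hA y hy
      refine ⟨y + 2 * m * j, ?_, hj⟩
      rw [c.ptl, Qpt_per m y j c.m0]
    · exact absurd h hx
  · rintro v ⟨i, hi, rfl⟩
    rcases (c.signed i).1 (hB hi) with rfl | rfl | ⟨k, rfl⟩
    · exact Or.inl (pt_n n)
    · exact Or.inl (pt_neg_n n)
    · obtain ⟨j, hj1, hj2⟩ := exists_rep (2 * m) k (a + 2 * m - 1) (by omega)
      right
      refine ⟨k + 2 * m * j, ?_, ?_, ?_⟩
      · rw [c.ptl, Qpt_per m k j c.m0]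
      · by_contra hcon
        refine hno (k + 2 * m * j) ?_ (by linarith) (by linarith)
        rw [lab_per]; exact hi
      · linarith

lemma not_crosses_of_disj {B B' : Set ℤ} (h : Disjoint (hullOf n B) (hullOf n B')) :
    ¬ Crosses n B B' := by
  rw [Set.disjoint_left] at h
  rintro ⟨_, ⟨x, h1, h2⟩ | ⟨x, h1, h2⟩⟩
  · exact h (intrinsicInterior_subset h2) h1
  · exact h h1 (intrinsicInterior_subset h2)

lemma Ctx.disj_central (c : Ctx n s p m g) {R : ℤ → ℤ → Prop} (hR : IsM1 p m R) {x z : ℤ}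
    (hx : ¬ R x (x + p)) (hz : R z (z + p)) :
    Disjoint (hullOf n (cls n p m R x)) (hullOf n (cls n p m R z)) := by
  have hp := c.hp
  have h3 := c.h3
  obtain ⟨a, b, hab, hb, ha, hb1, hA⟩ := c.arc hR hx
  refine c.disj_arc hx hab hb hA ((c.WW_part hR).2.1 _ (Or.inl ⟨z, rfl⟩)) ?_
  intro k hk h1 h2
  rw [c.lab_mem_cls hR] at hk
  have hkc := hR.central hk hz
  have hne : ∀ u, R x u → u ≠ k := by
    rintro u hu rfl
    exact hx (hR.central (hR.symm hu) hkc)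
  have hne1 := hne a ha
  have hne2 := hne b hb1
  have hr := hR.nc (x := a) (y := k) (z := b) (t := k + p) (by omega) (by omega) (by omega)
    (by omega) (hR.trans (hR.symm ha) hb1) hkc
  exact hne k (hR.trans ha hr) rfl

lemma Ctx.disj_nc (c : Ctx n s p m g) {R : ℤ → ℤ → Prop} (hR : IsM1 p m R) {x z : ℤ}
    (hx : ¬ R x (x + p)) (hz : ¬ R z (z + p)) (hxz : ¬ R x z) :
    Disjoint (hullOf n (cls n p m R x)) (hullOf n (cls n p m R z)) := by
  have hp := c.hp
  have h3 := c.h3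
  obtain ⟨a, b, hab, hb, ha, hb1, hA⟩ := c.arc hR hx
  obtain ⟨a', b', hab', hb', ha', hb1', hA'⟩ := c.arc hR hz
  have hne : ∀ u v, R x u → R z v → ¬ R u v := by
    intro u v hu hv huv
    exact hxz (hR.trans hu (hR.trans huv (hR.symm hv)))
  have hne' : ∀ u v, R x u → R z v → u ≠ v := by
    rintro u v hu hv rfl
    exact hne u u hu hv (hR.refl u)
  by_cases hcase : ∀ k, R z k → a ≤ k → k ≤ b → False
  · refine c.disj_arc hx hab hb hA ((c.WW_part hR).2.1 _ (Or.inl ⟨z, rfl⟩)) ?_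
    intro k hk
    rw [c.lab_mem_cls hR] at hk
    exact hcase k hk
  · push Not at hcase
    obtain ⟨k, hk, hk1, hk2, -⟩ := hcase
    obtain ⟨j, hj1, hj2⟩ := hA' k hk
    refine (c.disj_arc hz hab' hb' hA' ((c.WW_part hR).2.1 _ (Or.inl ⟨x, rfl⟩)) ?_).symm
    intro v hv hv1 hv2
    rw [c.lab_mem_cls hR] at hv
    obtain ⟨e, he⟩ : ∃ e, e = 2 * m * j := ⟨_, rfl⟩
    have w1 : ∀ u, R u (u - e) := by
      intro u
      have := hR.wrap_mul u (-j)
      rw [show u + 2 * m * (-j) = u - e by rw [he]; ring] at this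
      exact this
    rw [← he] at hj1 hj2
    have rA := hR.trans ha' (w1 a')
    have rB := hR.trans hb1' (w1 b')
    have rV := hR.trans hv (w1 v)
    have n1 := hne' a k ha hk
    have n2 := hne' b k hb1 hk
    have n3 := hne' _ _ rV rA
    have n4 := hne' _ _ rV rB
    have n5 := hne' _ _ ha rA
    rcases lt_or_gt_of_ne n5 with h | h
    · have := hR.nc (x := a) (y := a' - e) (z := v - e) (t := b' - e) h (by omega) (by omega)
        (by omega) (hR.trans (hR.symm ha) rV) (hR.trans (hR.symm rA) rB)
      exact hne _ _ ha rA this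
    · have := hR.nc (x := a' - e) (y := a) (z := k) (t := b) h (by omega) (by omega)
        (by omega) (hR.trans (hR.symm rA) hk) (hR.trans (hR.symm ha) hb1)
      exact hne _ _ ha rA (hR.symm this)

lemma Ctx.disj_sing (c : Ctx n s p m g) {R : ℤ → ℤ → Prop} (hR : IsM1 p m R) {x : ℤ}
    (hx : ¬ R x (x + p)) {B : Set ℤ} (hB : B = {(n:ℤ)} ∨ B = {-(n:ℤ)}) :
    Disjoint (hullOf n (cls n p m R x)) (hullOf n B) := by
  obtain ⟨a, b, hab, hb, ha, hb1, hA⟩ := c.arc hR hx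
  refine c.disj_arc hx hab hb hA ?_ ?_
  · rcases hB with rfl | rfl
    · rintro i rfl
      exact (c.signed _).2 (Or.inl rfl)
    · rintro i rfl
      exact (c.signed _).2 (Or.inr (Or.inl rfl))
  · intro k hk
    rcases hB with rfl | rfl
    · exact absurd hk (c.ne k).1
    · exact absurd hk (c.ne k).2

lemma Ctx.WW_NCD (c : Ctx n s p m g) {R : ℤ → ℤ → Prop} (hR : IsM1 p m R) :
    WW n p m R ∈ NCD n := by
  refine ⟨c.WW_Dn hR, ?_⟩
  have hs : ∀ B : Set ℤ, B = {(n:ℤ)} ∨ B = {-(n:ℤ)} → hullOf n B = {((0:ℝ), (0:ℝ))} := by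
    rintro B (rfl | rfl)
    · rw [hullOf, Set.image_singleton, pt_n, convexHull_singleton]
    · rw [hullOf, Set.image_singleton, pt_neg_n, convexHull_singleton]
  rintro B (⟨x, rfl⟩ | ⟨hno, hB⟩) B' (⟨z, rfl⟩ | ⟨hno', hB'⟩) hne
  · have hxz : ¬ R x z := fun h => hne (cls_eq hR h)
    apply not_crosses_of_disj
    by_cases hx : R x (x + p)
    · by_cases hz : R z (z + p)
      · exact absurd (hR.two_central c.hp c.h3 hx hz) hxz
      · exact (c.disj_central hR hz hx).symm
    · by_cases hz : R z (z + p)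
      · exact c.disj_central hR hx hz
      · exact c.disj_nc hR hx hz hxz
  · exact not_crosses_of_disj (c.disj_sing hR (hno' x) hB')
  · exact not_crosses_of_disj (c.disj_sing hR (hno z) hB).symm
  · intro hc
    exact hc.1 (by rw [hs B hB, hs B' hB'])

end backward

lemma Ctx.card {n s : ℕ} {p m : ℤ} {g : ℤ → ℤ} (c : Ctx n s p m g) :
    Nat.card {w : Set (Set ℤ) // w ∈ NCD n ∧ InvUnder g w} = Nat.card {R // IsM1 p m R} :=
  Nat.card_congr
    { toFun := fun w => ⟨relOf m w.1, c.rel_isM1 w.2.1 w.2.2⟩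
      invFun := fun R => ⟨WW n p m R.1, c.WW_NCD R.2, c.WW_inv R.2⟩
      left_inv := fun w => Subtype.ext (c.w_eq w.2.1 w.2.2).symm
      right_inv := fun R => Subtype.ext (c.rel_WW R.2) }

/-- Assume `n` is even, let `1 ≤ s ≤ 2n-3` with `s ≠ n-1`, and let `p = gcd(n-1, s)`. Then
the number of elements of `NC^D(n)` invariant under `σ^(s+1) ∘ ρ^s` equals `C(2p, p)`. -/
theorem number_of_sigma_pow_rho_pow_invariant_NCD (n s : ℕ) (hn : 4 ≤ n) (hneven : Even n)
    (hs1 : 1 ≤ s) (hs2 : s ≤ 2 * n - 3) (hs3 : s ≠ n - 1) :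
    Nat.card {w : Set (Set ℤ) //
        w ∈ NCD n ∧ InvUnder ((sigmaFun n)^[s + 1] ∘ (rhoFun n)^[s]) w} =
      (2 * Nat.gcd (n - 1) s).choose (Nat.gcd (n - 1) s) := by
  obtain ⟨p, hpdef⟩ : ∃ p, p = Nat.gcd (n - 1) s := ⟨_, rfl⟩
  have hp0 : 0 < p := by rw [hpdef]; exact Nat.gcd_pos_of_pos_right _ hs1
  have hpm : p ∣ n - 1 := by rw [hpdef]; exact Nat.gcd_dvd_left _ _
  have hps : p ∣ s := by rw [hpdef]; exact Nat.gcd_dvd_right _ _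
  have hcast : ((n - 1 : ℕ) : ℤ) = (n:ℤ) - 1 := by push_cast [show 1 ≤ n by omega]; ring
  have h3 : 3 * p ≤ n - 1 := by
    obtain ⟨q, hq⟩ := hpm
    obtain ⟨e, he⟩ := hneven
    have q0 : q ≠ 0 := by rintro rfl; omega
    have q1 : q ≠ 1 := by
      rintro rfl
      rw [mul_one] at hq
      obtain ⟨r, hr⟩ := hps
      have r0 : r ≠ 0 := by rintro rfl; omega
      have r1 : r ≠ 1 := by rintro rfl; omega
      have : p * 2 ≤ p * r := Nat.mul_le_mul_left p (by omega)
      omega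
    have q2 : q ≠ 2 := by rintro rfl; omega
    have : p * 3 ≤ p * q := Nat.mul_le_mul_left p (by omega)
    omega
  have h3' : 3 * (p:ℤ) ≤ (n:ℤ) - 1 := by rw [← hcast]; exact_mod_cast h3
  have hpm' : (p:ℤ) ∣ (n:ℤ) - 1 := by rw [← hcast]; exact_mod_cast hpm
  have c : Ctx n s p ((n:ℤ) - 1) ((sigmaFun n)^[s + 1] ∘ (rhoFun n)^[s]) :=
    { hn := hn
      hm := rfl
      modd := by
        obtain ⟨e, he⟩ := hneven
        exact ⟨(e:ℤ) - 1, by rw [he]; push_cast; ring⟩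
      hp := by exact_mod_cast hp0
      hpm := hpm'
      h3 := h3'
      bez := by
        refine ⟨Nat.gcdA (n - 1) s, Nat.gcdB (n - 1) s, ?_⟩
        rw [hpdef, ← hcast]; exact Nat.gcd_eq_gcd_ab _ _
      hps := by exact_mod_cast hps
      g1 := g_lab n hn s
      g2 := g_n n hn s }
  rw [c.card, ← hpdef]
  exact M1_card p _ hp0 h3' hpm'
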